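/- arXiv:2505.09648 — 3 statements merged into one kernel-verified Lean document; each statement's English description precedes it below -/
import Mathlib

section
/- Let n ≥ 10 be even and let {aᵢ}, {bᵢ}, {cᵢ} (0 ≤ i ≤ n-1) be decreasing sequences in [0,1] with averages A, B, C respectively. If for all triples (i,j,k) with i + j + k ≥ n we have aᵢbⱼ + bⱼc_k + c_k aᵢ ≤ (1/2)(aᵢ + bⱼ + c_k), then AB + BC + CA ≤ (1/2)(A + B + C). -/
/-- The defect `xy + yz + zx - (x + y + z) / 2` of the inequality. -/
noncomputable def pairDefect (x y z : ℝ) : ℝ := x * y + y * z + z * x - (1 / 2) * (x + y + z)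

theorem pairDefect_rotate (x y z : ℝ) : pairDefect y z x = pairDefect x y z := by
  unfold pairDefect; ring

/-- Summing the defect over the Latin square `i + j + k = 0` of order `m`. -/
theorem sum_pairDefect_latin (m : ℕ) [NeZero m] (u v w : Fin m → ℝ) :
    ∑ i, ∑ j, pairDefect (u i) (v j) (w (-i - j)) =
      (∑ i, u i) * (∑ i, v i) + (∑ i, v i) * (∑ i, w i) + (∑ i, w i) * (∑ i, u i) -
        m / 2 * (∑ i, u i + ∑ i, v i + ∑ i, w i) := by
  have hrow : ∀ i : Fin m, ∑ j, w (-i - j) = ∑ k, w k := fun i =>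
    Equiv.sum_comp (Equiv.subLeft (-i)) w
  have hcol : ∀ j : Fin m, ∑ i, w (-i - j) = ∑ k, w k := fun j => by
    rw [← Equiv.sum_comp (Equiv.subLeft (-j)) w]
    refine Finset.sum_congr rfl fun i _ => ?_
    simp only [Equiv.subLeft_apply]
    congr 1
    abel
  have huv : ∑ i, u i * ∑ j, v j = (∑ i, u i) * ∑ j, v j := (Finset.sum_mul ..).symm
  have hvw : ∑ i, ∑ j, v j * w (-i - j) = (∑ j, v j) * ∑ k, w k := by
    rw [Finset.sum_comm, Finset.sum_mul]
    exact Finset.sum_congr rfl fun j _ => by rw [← Finset.mul_sum, hcol]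
  have hwu : ∑ i, ∑ j, w (-i - j) * u i = (∑ k, w k) * ∑ i, u i := by
    rw [Finset.mul_sum]
    exact Finset.sum_congr rfl fun i _ => by rw [← Finset.sum_mul, hrow]
  simp only [pairDefect, Finset.sum_sub_distrib, Finset.sum_add_distrib, ← Finset.mul_sum,
    huv, hvw, hwu, hrow, Finset.sum_const, Finset.card_univ, Fintype.card_fin, nsmul_eq_mul]
  ring

theorem sums_le_pairDefect_zero (m : ℕ) (hm : 0 < m) (u v w : ℕ → ℝ)
    (h : ∀ i j k, i < m → j < m → k < m → m ≤ i + j + k → pairDefect (u i) (v j) (w k) ≤ 0) :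
    (∑ i ∈ Finset.range m, u i) * (∑ i ∈ Finset.range m, v i) +
      (∑ i ∈ Finset.range m, v i) * (∑ i ∈ Finset.range m, w i) +
      (∑ i ∈ Finset.range m, w i) * (∑ i ∈ Finset.range m, u i) -
      m / 2 * (∑ i ∈ Finset.range m, u i + ∑ i ∈ Finset.range m, v i +
        ∑ i ∈ Finset.range m, w i) ≤ pairDefect (u 0) (v 0) (w 0) := by
  have : NeZero m := ⟨hm.ne'⟩
  have key : ∀ i j : Fin m, (i, j) ≠ (0, 0) →
      pairDefect (u i) (v j) (w (-i - j : Fin m)) ≤ 0 := by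
    intro i j hij
    refine h _ _ _ i.2 j.2 (-i - j : Fin m).2 ?_
    by_contra! hlt
    have hsum : i + j + (-i - j) = 0 := by abel
    have hval := congrArg Fin.val hsum
    simp only [Fin.val_add, Fin.val_zero, Nat.mod_add_mod] at hval
    rw [Nat.mod_eq_of_lt hlt] at hval
    apply hij
    ext <;> simp only [Fin.val_zero] at hval ⊢ <;> omega
  have hle : ∑ p : Fin m × Fin m, pairDefect (u p.1) (v p.2) (w (-p.1 - p.2 : Fin m)) ≤
      pairDefect (u 0) (v 0) (w 0) := by
    rw [← Finset.add_sum_erase _ _ (Finset.mem_univ ((0, 0) : Fin m × Fin m))]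
    have hrest := Finset.sum_nonpos fun p
      (hp : p ∈ (Finset.univ : Finset (Fin m × Fin m)).erase (0, 0)) =>
        key p.1 p.2 (Finset.ne_of_mem_erase hp)
    simp only [neg_zero, sub_zero, Fin.val_zero] at hrest ⊢
    linarith
  rw [Fintype.sum_prod_type,
    sum_pairDefect_latin m (fun i => u i) (fun i => v i) (fun i => w i)] at hle
  simpa only [Finset.sum_range] using hle

theorem pairDefect_le_of_sum_le {x y z : ℝ} :
    pairDefect x y z ≤ -((x + y + z) * (1 / 2 - (x + y + z) / 3)) := by
  unfold pairDefect
  nlinarith [sq_nonneg (x - y), sq_nonneg (y - z), sq_nonneg (z - x)]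

theorem sum_le_two_of_pairDefect_nonpos {x y z : ℝ} (hx : x ≤ 1) (hy : y ≤ 1) (hz : z ≤ 1)
    (h : pairDefect x y z ≤ 0) : x + y + z ≤ 2 := by
  unfold pairDefect at h
  nlinarith [mul_nonneg (sub_nonneg.2 hx) (sub_nonneg.2 hy),
    mul_nonneg (sub_nonneg.2 hy) (sub_nonneg.2 hz), mul_nonneg (sub_nonneg.2 hz) (sub_nonneg.2 hx)]

theorem pairDefect_le_of_add_lt_half {x y z : ℝ} (hs : 6 / 5 < x + y + z) (h : y + z < 1 / 2) :
    pairDefect x y z ≤ -(3 / 25) := by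
  unfold pairDefect
  nlinarith [sq_nonneg (y - z),
    mul_nonneg (sub_nonneg.2 hs.le) (sub_nonneg.2 h.le), sq_nonneg (y + z - 1 / 2)]

theorem pairDefect_mono {x y z x' y' z' : ℝ} (hx : x ≤ x') (hy : y ≤ y') (hz : z ≤ z')
    (h₁ : 1 / 2 ≤ y + z) (h₂ : 1 / 2 ≤ z + x) (h₃ : 1 / 2 ≤ x + y) :
    pairDefect x y z ≤ pairDefect x' y' z' := by
  unfold pairDefect
  have := mul_nonneg (sub_nonneg.2 hx) (sub_nonneg.2 hy)
  have := mul_nonneg (sub_nonneg.2 hy) (sub_nonneg.2 hz)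
  have := mul_nonneg (sub_nonneg.2 hz) (sub_nonneg.2 hx)
  have := mul_nonneg (sub_nonneg.2 hx) (sub_nonneg.2 h₁)
  have := mul_nonneg (sub_nonneg.2 hy) (sub_nonneg.2 h₂)
  have := mul_nonneg (sub_nonneg.2 hz) (sub_nonneg.2 h₃)
  linarith

theorem sum_pairDefect_le {x y z p q r : ℝ} (hp : 0 ≤ p) (hq : 0 ≤ q) (hr : 0 ≤ r)
    (hx : 0 ≤ x ∧ x ≤ 1) (hy : 0 ≤ y ∧ y ≤ 1) (hz : 0 ≤ z ∧ z ≤ 1) :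
    pairDefect x y r + pairDefect y z p + pairDefect z x q ≤ 3 / 2 * (p + q + r) := by
  have hb : ∀ {s t w : ℝ}, 0 ≤ w → 0 ≤ s ∧ s ≤ 1 → 0 ≤ t ∧ t ≤ 1 →
      pairDefect s t w ≤ 3 / 2 * w := by
    intro s t w hw hs ht
    unfold pairDefect
    nlinarith [mul_nonneg hs.1 (sub_nonneg.2 ht.2), mul_nonneg ht.1 (sub_nonneg.2 hs.2),
      mul_nonneg hw (sub_nonneg.2 hs.2), mul_nonneg hw (sub_nonneg.2 ht.2)]
  linarith [hb hr hx hy, hb hp hy hz, hb hq hz hx]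

theorem pairDefect_corner_of_max {x y z p q r : ℝ} (hp : 0 ≤ p) (hq : 0 ≤ q) (hr : 0 ≤ r)
    (hx : p ≤ x ∧ x ≤ 1) (hy : q ≤ y ∧ y ≤ 1) (hz : r ≤ z ∧ z ≤ 1)
    (hs : 6 / 5 < p + q + r) (hqp : q ≤ p) (hrp : r ≤ p)
    (h₁ : pairDefect x q r ≤ 0) (h₂ : pairDefect p y r ≤ 0) (h₃ : pairDefect p q z ≤ 0) :
    25 * pairDefect p q r + (pairDefect x y r + pairDefect y z p + pairDefect z x q) ≤ 0 := by
  obtain ⟨s, rfl⟩ : ∃ s, x = p + s := ⟨x - p, by ring⟩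
  obtain ⟨t, rfl⟩ : ∃ t, y = q + t := ⟨y - q, by ring⟩
  obtain ⟨w, rfl⟩ : ∃ w, z = r + w := ⟨z - r, by ring⟩
  have hs0 : 0 ≤ s := by linarith
  have ht0 : 0 ≤ t := by linarith
  have hw0 : 0 ≤ w := by linarith
  have hs1 : s ≤ 3 / 5 := by linarith
  have hw1 : w ≤ 1 := by linarith
  have hL₂ : 1 / 10 ≤ p + r - 1 / 2 := by
    by_cases hp6 : 3 / 5 ≤ p <;> linarith
  have hL₃ : 1 / 10 ≤ p + q - 1 / 2 := by
    by_cases hp6 : 3 / 5 ≤ p <;> linarith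
  obtain ⟨F, hF⟩ : ∃ F, F = -pairDefect p q r := ⟨_, rfl⟩
  have e₁ : s * (q + r - 1 / 2) ≤ F := by unfold pairDefect at *; linarith
  have e₂ : t * (p + r - 1 / 2) ≤ F := by unfold pairDefect at *; linarith
  have e₃ : w * (p + q - 1 / 2) ≤ F := by unfold pairDefect at *; linarith
  have ht : t ≤ 10 * F := by nlinarith
  have hw : w ≤ 10 * F := by nlinarith
  have hst : s * t ≤ 6 * F := by nlinarith
  have hsw : s * w ≤ 6 * F := by nlinarith
  have htw : t * w ≤ 10 * F := by nlinarith
  unfold pairDefect at *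
  linarith

theorem pairDefect_corner {x y z p q r : ℝ} (hp : 0 ≤ p) (hq : 0 ≤ q) (hr : 0 ≤ r)
    (hx : p ≤ x ∧ x ≤ 1) (hy : q ≤ y ∧ y ≤ 1) (hz : r ≤ z ∧ z ≤ 1)
    (hs : 6 / 5 < p + q + r)
    (h₁ : pairDefect x q r ≤ 0) (h₂ : pairDefect p y r ≤ 0) (h₃ : pairDefect p q z ≤ 0) :
    25 * pairDefect p q r + (pairDefect x y r + pairDefect y z p + pairDefect z x q) ≤ 0 := by
  have rot := pairDefect_rotate
  have hmax : (q ≤ p ∧ r ≤ p) ∨ (r ≤ q ∧ p ≤ q) ∨ (p ≤ r ∧ q ≤ r) := by grind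
  rcases hmax with ⟨h, h'⟩ | ⟨h, h'⟩ | ⟨h, h'⟩
  · exact pairDefect_corner_of_max hp hq hr hx hy hz hs h h' h₁ h₂ h₃
  · have := pairDefect_corner_of_max hq hr hp hy hz hx (by linarith) h h'
      (by rwa [rot]) (by rwa [rot]) (by rwa [rot])
    linarith [rot p q r]
  · have := pairDefect_corner_of_max hr hp hq hz hx hy (by linarith) h h'
      (by rwa [← rot]) (by rwa [← rot]) (by rwa [← rot])
    linarith [rot r p q]

theorem sq_mul_pairDefect_add_le {m x y z p q r P Q R : ℝ} (hm : 5 ≤ m)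
    (hp : 0 ≤ p) (hq : 0 ≤ q) (hr : 0 ≤ r)
    (hx : p ≤ x ∧ x ≤ 1) (hy : q ≤ y ∧ y ≤ 1) (hz : r ≤ z ∧ z ≤ 1)
    (hP : p ≤ m * P ∧ P ≤ p) (hQ : q ≤ m * Q ∧ Q ≤ q) (hR : r ≤ m * R ∧ R ≤ r)
    (h₀ : pairDefect p q r ≤ 0)
    (h₁ : pairDefect x q r ≤ 0) (h₂ : pairDefect p y r ≤ 0) (h₃ : pairDefect p q z ≤ 0) :
    m ^ 2 * pairDefect P Q R +
      (pairDefect x y r + pairDefect y z p + pairDefect z x q) ≤ 0 := by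
  have hcoarse := sum_pairDefect_le hp hq hr ⟨hp.trans hx.1, hx.2⟩ ⟨hq.trans hy.1, hy.2⟩
    ⟨hr.trans hz.1, hz.2⟩
  have hs := sum_le_two_of_pairDefect_nonpos (hx.1.trans hx.2) (hy.1.trans hy.2)
    (hz.1.trans hz.2) h₀
  have hm2 : 25 ≤ m ^ 2 := by nlinarith
  have hsuff : pairDefect P Q R ≤ -(3 / 25) → m ^ 2 * pairDefect P Q R +
      (pairDefect x y r + pairDefect y z p + pairDefect z x q) ≤ 0 := by
    intro hneg
    linarith [mul_le_mul_of_nonneg_left hneg (sq_nonneg m)]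
  rcases le_or_gt (P + Q + R) (6 / 5) with hS | hS
  · have hf := pairDefect_le_of_sum_le (x := P) (y := Q) (z := R)
    obtain ⟨S, hSdef⟩ : ∃ S, S = P + Q + R := ⟨_, rfl⟩
    rw [← hSdef] at hf hS
    rcases le_or_gt S (3 / 5) with hS' | hS'
    · have hmS : p + q + r ≤ m * S := by rw [hSdef]; linarith
      have hslope : 3 / 2 ≤ m * (1 / 2 - S / 3) := by
        linarith [mul_le_mul_of_nonneg_right hm (show 0 ≤ 1 / 2 - S / 3 by linarith)]
      have hprod := mul_le_mul hmS hslope (by norm_num) (by linarith)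
      have hscaled := mul_le_mul_of_nonneg_left hf (sq_nonneg m)
      linarith
    · refine hsuff (hf.trans ?_)
      linarith [mul_nonneg (sub_nonneg.2 hS'.le) (sub_nonneg.2 hS)]
  · by_cases hL₁ : Q + R < 1 / 2
    · exact hsuff (pairDefect_le_of_add_lt_half hS hL₁)
    by_cases hL₂ : R + P < 1 / 2
    · exact hsuff (pairDefect_rotate P Q R ▸ pairDefect_le_of_add_lt_half (by linarith) hL₂)
    by_cases hL₃ : P + Q < 1 / 2
    · exact hsuff (pairDefect_rotate R P Q ▸ pairDefect_le_of_add_lt_half (by linarith) hL₃)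
    have hmono := pairDefect_mono hP.2 hQ.2 hR.2 (not_lt.1 hL₁) (not_lt.1 hL₂) (not_lt.1 hL₃)
    have := pairDefect_corner hp hq hr hx hy hz (by linarith [hP.2, hQ.2, hR.2]) h₁ h₂ h₃
    have hneg := mul_le_mul_of_nonneg_left (hmono.trans h₀) (sub_nonneg.2 hm2)
    linarith

theorem le_sum_range_and_le (m : ℕ) (hm : 0 < m) (u : ℕ → ℝ) (h0 : ∀ i < m, 0 ≤ u i)
    (hle : ∀ i < m, u i ≤ u 0) :
    u 0 ≤ ∑ i ∈ Finset.range m, u i ∧ ∑ i ∈ Finset.range m, u i ≤ m * u 0 := by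
  constructor
  · exact Finset.single_le_sum (f := u) (fun i hi => h0 i (Finset.mem_range.1 hi))
      (Finset.mem_range.2 hm)
  · simpa using Finset.sum_le_card_nsmul (Finset.range m) u (u 0)
      fun i hi => hle i (Finset.mem_range.1 hi)

theorem stmt_2 (n : ℕ) (hn : 10 ≤ n) (hne : Even n) (a b c : ℕ → ℝ)
    (hamem : ∀ i, i < n → a i ∈ Set.Icc (0 : ℝ) 1)
    (hbmem : ∀ i, i < n → b i ∈ Set.Icc (0 : ℝ) 1)
    (hcmem : ∀ i, i < n → c i ∈ Set.Icc (0 : ℝ) 1)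
    (hadec : ∀ i j, i ≤ j → j < n → a j ≤ a i)
    (hbdec : ∀ i j, i ≤ j → j < n → b j ≤ b i)
    (hcdec : ∀ i j, i ≤ j → j < n → c j ≤ c i)
    (h : ∀ i j k, i < n → j < n → k < n → n ≤ i + j + k →
      a i * b j + b j * c k + c k * a i ≤ (1 / 2) * (a i + b j + c k))
    (A B C : ℝ)
    (hA : A = (1 / n : ℝ) * ∑ i ∈ Finset.range n, a i)
    (hB : B = (1 / n : ℝ) * ∑ i ∈ Finset.range n, b i)
    (hC : C = (1 / n : ℝ) * ∑ i ∈ Finset.range n, c i) :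
    A * B + B * C + C * A ≤ (1 / 2) * (A + B + C) := by
  obtain ⟨m, rfl⟩ := hne
  have hm : 5 ≤ m := by omega
  have hmR : (5 : ℝ) ≤ m := by exact_mod_cast hm
  have hD : ∀ i j k, i < m + m → j < m + m → k < m + m → m + m ≤ i + j + k →
      pairDefect (a i) (b j) (c k) ≤ 0 := fun i j k hi hj hk hs =>
    sub_nonpos.2 (h i j k hi hj hk hs)
  have hcorner : ∀ d : ℕ → ℝ, (∀ i, i < m + m → d i ∈ Set.Icc (0 : ℝ) 1) →
      (∀ i j, i ≤ j → j < m + m → d j ≤ d i) →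
      0 ≤ d m ∧ (d m ≤ d 0 ∧ d 0 ≤ 1) ∧
        (d m ≤ m * ((∑ i ∈ Finset.range m, d (m + i)) / m) ∧
          (∑ i ∈ Finset.range m, d (m + i)) / m ≤ d m) := by
    intro d hd hdec
    have hsum := le_sum_range_and_le m (by omega) (fun i => d (m + i))
      (fun i hi => (hd (m + i) (by omega)).1) (fun i hi => hdec _ _ (by omega) (by omega))
    refine ⟨(hd m (by omega)).1, ⟨hdec _ _ (by omega) (by omega), (hd 0 (by omega)).2⟩, ?_, ?_⟩
    · rw [mul_div_cancel₀ _ (by positivity)]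
      exact hsum.1
    · rw [div_le_iff₀ (by positivity), mul_comm]
      exact hsum.2
  obtain ⟨hp, hx, hP⟩ := hcorner a hamem hadec
  obtain ⟨hq, hy, hQ⟩ := hcorner b hbmem hbdec
  obtain ⟨hr, hz, hR⟩ := hcorner c hcmem hcdec
  have hmain := sq_mul_pairDefect_add_le hmR hp hq hr hx hy hz hP hQ hR
    (hD m m m (by omega) (by omega) (by omega) (by omega))
    (hD 0 m m (by omega) (by omega) (by omega) (by omega))
    (hD m 0 m (by omega) (by omega) (by omega) (by omega))
    (hD m m 0 (by omega) (by omega) (by omega) (by omega))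
  have habc := sums_le_pairDefect_zero m (by omega) a b (fun i => c (m + i))
    fun i j k hi hj hk hs => hD i j (m + k) (by omega) (by omega) (by omega) (by omega)
  have hbca := sums_le_pairDefect_zero m (by omega) b c (fun i => a (m + i))
    fun i j k hi hj hk hs => by
      rw [pairDefect_rotate]
      exact hD (m + k) i j (by omega) (by omega) (by omega) (by omega)
  have hcab := sums_le_pairDefect_zero m (by omega) c a (fun i => b (m + i))
    fun i j k hi hj hk hs => by
      rw [← pairDefect_rotate]
      exact hD j (m + k) i (by omega) (by omega) (by omega) (by omega)
  rw [Finset.sum_range_add] at hA hB hC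
  simp only [add_zero] at habc hbca hcab
  generalize ∑ i ∈ Finset.range m, a i = Ha at *
  generalize ∑ i ∈ Finset.range m, b i = Hb at *
  generalize ∑ i ∈ Finset.range m, c i = Hc at *
  generalize ∑ i ∈ Finset.range m, a (m + i) = Qa at *
  generalize ∑ i ∈ Finset.range m, b (m + i) = Qb at *
  generalize ∑ i ∈ Finset.range m, c (m + i) = Qc at *
  have hscale : (m : ℝ) ^ 2 * pairDefect (Qa / m) (Qb / m) (Qc / m) =
      Qa * Qb + Qb * Qc + Qc * Qa - m / 2 * (Qa + Qb + Qc) := by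
    unfold pairDefect
    field_simp
  have hn2 : (0 : ℝ) < (m + m) ^ 2 := by positivity
  have htotal : ((m : ℝ) + m) ^ 2 * (A * B + B * C + C * A - 1 / 2 * (A + B + C)) ≤ 0 := by
    have hexp : ((m : ℝ) + m) ^ 2 * (A * B + B * C + C * A - 1 / 2 * (A + B + C)) =
        (Ha + Qa) * (Hb + Qb) + (Hb + Qb) * (Hc + Qc) + (Hc + Qc) * (Ha + Qa) -
          m * (Ha + Qa + (Hb + Qb) + (Hc + Qc)) := by
      rw [hA, hB, hC]
      push_cast
      field_simp
      ring
    rw [hexp]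
    linarith
  exact sub_nonpos.1 (nonpos_of_mul_nonpos_right htotal hn2)
end

section
/- Let m be an odd squarefree integer with (m, 30) = 1 and let f : (ℤ/mℤ)* → [0,1] satisfy ∑_{a ∈ (ℤ/mℤ)*} f(a) > φ(m)/2. Then for any x ∈ ℤ/mℤ there exist units a₁, a₂, a₃ with x = a₁ + a₂ + a₃ and f(a₁)f(a₂) + f(a₂)f(a₃) + f(a₃)f(a₁) > (1/2)(f(a₁) + f(a₂) + f(a₃)). -/
open Finset

section Combinatorics

variable {G : Type*} [AddCommGroup G] [Fintype G] [DecidableEq G]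

/-- The pairs `(i, j)` for which none of `i`, `j` and `-i - j` vanishes. -/
def zeroSumTriples (G : Type*) [AddCommGroup G] [Fintype G] [DecidableEq G] : Finset (G × G) :=
  {t | t.1 ≠ 0 ∧ t.2 ≠ 0 ∧ t.2 ≠ -t.1}

theorem mem_zeroSumTriples {t : G × G} :
    t ∈ zeroSumTriples G ↔ t.1 ≠ 0 ∧ t.2 ≠ 0 ∧ t.2 ≠ -t.1 := by
  simp [zeroSumTriples]

theorem sum_zeroSumTriples_eq_sum_sum (F : G × G → ℝ) :
    ∑ t ∈ zeroSumTriples G, F t =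
      ∑ i ∈ univ.erase 0, ∑ j ∈ (univ.erase 0).erase (-i), F (i, j) := by
  apply sum_finset_product
  rintro ⟨i, j⟩
  simp only [mem_zeroSumTriples, mem_erase, mem_univ, and_true]
  tauto

theorem sum_zeroSumTriples_fst (u : G → ℝ) :
    ∑ t ∈ zeroSumTriples G, u t.1 =
      ((Fintype.card G : ℝ) - 2) * ∑ i ∈ univ.erase 0, u i := by
  rw [sum_zeroSumTriples_eq_sum_sum, mul_sum]
  refine sum_congr rfl fun i hi => ?_
  have hi0 : i ≠ 0 := ne_of_mem_erase hi
  have hmem : -i ∈ (univ : Finset G).erase 0 := by simpa using hi0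
  have h1 := card_erase_add_one hmem
  have h2 := card_erase_add_one (mem_univ (0 : G))
  rw [card_univ] at h2
  have h3 : (#(((univ : Finset G).erase 0).erase (-i)) : ℝ) = (Fintype.card G : ℝ) - 2 := by
    rw [← h2, ← h1]; push_cast; ring
  simp [← h3]

theorem sum_zeroSumTriples_rotate (F : G → G → ℝ) :
    ∑ t ∈ zeroSumTriples G, F t.2 (-t.1 - t.2) = ∑ t ∈ zeroSumTriples G, F t.1 t.2 := by
  refine sum_nbij' (fun t => (t.2, -t.1 - t.2)) (fun t => (-t.1 - t.2, t.1)) ?_ ?_ ?_ ?_ ?_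
  · rintro ⟨i, j⟩ h
    simp only [mem_zeroSumTriples] at h ⊢
    refine ⟨h.2.1, fun h' => h.2.2 ?_, fun h' => h.1 ?_⟩
    · rw [sub_eq_zero] at h'; exact h'.symm
    · simpa using h'
  · rintro ⟨i, j⟩ h
    simp only [mem_zeroSumTriples] at h ⊢
    refine ⟨fun h' => h.2.2 ?_, h.1, fun h' => h.2.1 ?_⟩
    · rw [sub_eq_zero] at h'; exact h'.symm
    · have : i = i + j := by simpa [add_comm] using h'
      simpa using this
  · rintro ⟨i, j⟩ _
    ext
    · change -j - (-i - j) = i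
      abel
    · rfl
  · rintro ⟨i, j⟩ _
    simp
  · simp

theorem sum_zeroSumTriples_neg (F : G → G → ℝ) :
    ∑ t ∈ zeroSumTriples G, F (-t.1) (-t.2) = ∑ t ∈ zeroSumTriples G, F t.1 t.2 := by
  refine sum_nbij' (fun t => -t) (fun t => -t) ?_ ?_ ?_ ?_ ?_ <;>
    simp +contextual [mem_zeroSumTriples, neg_eq_iff_eq_neg]

theorem sum_sum_eq_add_sum_zeroSumTriples (F : G → G → ℝ) :
    ∑ i, ∑ j, F i j = F 0 0 + (∑ i ∈ univ.erase 0, F 0 i + ∑ i ∈ univ.erase 0, F i 0 +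
      ∑ i ∈ univ.erase 0, F i (-i)) + ∑ t ∈ zeroSumTriples G, F t.1 t.2 := by
  rw [sum_zeroSumTriples_eq_sum_sum (fun t => F t.1 t.2)]
  have h : ∀ i ∈ univ.erase (0 : G),
      ∑ j, F i j = F i 0 + F i (-i) + ∑ j ∈ (univ.erase 0).erase (-i), F i j := by
    intro i hi
    have hmem : -i ∈ (univ : Finset G).erase 0 := by simpa using ne_of_mem_erase hi
    rw [← add_sum_erase _ _ (mem_univ (0 : G)), ← add_sum_erase _ _ hmem, add_assoc]
  rw [← add_sum_erase _ _ (mem_univ (0 : G)), sum_congr rfl h, sum_add_distrib, sum_add_distrib,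
    ← add_sum_erase _ _ (mem_univ (0 : G))]
  ring

/-- A tent-function estimate: the deficiency of a pair is controlled by its excess. -/
theorem one_sub_le_tent_add_tent {u v t : ℝ} (hu : 0 ≤ u) (hv : 0 ≤ v) (ht : 0 ≤ t)
    (h : u + v = 1 + t) :
    1 - t ≤ min u (2 - u) + min v (2 - v) := by
  rcases min_cases u (2 - u) with ⟨h1, _⟩ | ⟨h1, _⟩ <;>
    rcases min_cases v (2 - v) with ⟨h2, _⟩ | ⟨h2, _⟩ <;> rw [h1, h2] <;> linarith

theorem le_sum_tent_zeroSumTriples {x y z : G → ℝ}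
    (hx : ∀ i, x i ∈ Set.Icc (0 : ℝ) 1) (hy : ∀ i, y i ∈ Set.Icc (0 : ℝ) 1)
    (hz : ∀ i, z i ∈ Set.Icc (0 : ℝ) 1) (hx0 : x 0 = 0) (hy0 : y 0 = 0) (hz0 : z 0 = 0)
    (h : ∀ i j, i ≠ 0 ∨ j ≠ 0 → 1 ≤ x i + y j + z (-i - j)) :
    ((Fintype.card G : ℝ) - 2) * ((Fintype.card G - 1) -
      (∑ i ∈ univ.erase 0, (x i + y (-i) - 1) + ∑ i ∈ univ.erase 0, (y i + z (-i) - 1) +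
        ∑ i ∈ univ.erase 0, (z i + x (-i) - 1))) ≤
    2 * ∑ t ∈ zeroSumTriples G,
      min (x t.1 + y t.2 + z (-t.1 - t.2) - 1) (2 - (x t.1 + y t.2 + z (-t.1 - t.2) - 1)) := by
  set M : G → G → ℝ := fun i j =>
    min (x i + y j + z (-i - j) - 1) (2 - (x i + y j + z (-i - j) - 1)) with hM
  have hsig : ∑ t ∈ zeroSumTriples G, M (t.1 + t.2) (-t.1) = ∑ t ∈ zeroSumTriples G, M t.1 t.2 := by
    calc _ = ∑ t ∈ zeroSumTriples G, M (- -t.1 - -t.2) (-t.1) := by simp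
      _ = ∑ t ∈ zeroSumTriples G, M (-t.1 - t.2) t.1 :=
        sum_zeroSumTriples_neg (fun i j => M (-i - j) i)
      _ = ∑ t ∈ zeroSumTriples G, M (-t.2 - (-t.1 - t.2)) t.2 :=
        (sum_zeroSumTriples_rotate (fun i j => M (-i - j) i)).symm
      _ = _ := by simp [sub_eq_add_neg, add_comm]
  have h1 := sum_zeroSumTriples_fst (fun i => x i + y (-i) - 1)
  have h2 : ∑ t ∈ zeroSumTriples G, (y t.2 + z (-t.2) - 1) = _ :=
    (sum_zeroSumTriples_rotate (fun i _ => y i + z (-i) - 1)).trans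
      (sum_zeroSumTriples_fst (fun i => y i + z (-i) - 1))
  have h3 : ∑ t ∈ zeroSumTriples G, (z (-t.1 - t.2) + x (-(-t.1 - t.2)) - 1) = _ :=
    ((sum_zeroSumTriples_rotate (fun _ j => z j + x (-j) - 1)).trans
      (sum_zeroSumTriples_rotate (fun i _ => z i + x (-i) - 1))).trans
      (sum_zeroSumTriples_fst (fun i => z i + x (-i) - 1))
  have h4 : ∑ t ∈ zeroSumTriples G, (1 : ℝ) = _ := sum_zeroSumTriples_fst (fun _ : G => (1 : ℝ))
  have hc : ∑ i ∈ univ.erase (0 : G), (1 : ℝ) = Fintype.card G - 1 := by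
    have := card_erase_add_one (mem_univ (0 : G))
    rw [card_univ] at this
    rw [← this]; simp
  rw [hc] at h4
  have key : ∑ t ∈ zeroSumTriples G, (1 - ((x t.1 + y (-t.1) - 1) + (y t.2 + z (-t.2) - 1) +
      (z (-t.1 - t.2) + x (-(-t.1 - t.2)) - 1))) ≤
      ∑ t ∈ zeroSumTriples G, (M t.1 t.2 + M (t.1 + t.2) (-t.1)) := by
    refine sum_le_sum ?_
    rintro ⟨i, j⟩ ht
    obtain ⟨hi, hj, hk⟩ := mem_zeroSumTriples.1 ht
    simp only at hi hj hk ⊢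
    have hk' : -i - j ≠ 0 := fun h' => hk (sub_eq_zero.1 h').symm
    have e1 : -(i + j) - -i = -j := by abel
    have e2 : -(-i - j) = i + j := by abel
    have c1 := h i j (Or.inl hi)
    have c2 := h (i + j) (-i) (Or.inr (neg_ne_zero.2 hi))
    have c3 := h i (-i) (Or.inl hi)
    have c4 := h 0 j (Or.inr hj)
    have c5 := h (i + j) 0 (Or.inl (by rw [← e2]; exact neg_ne_zero.2 hk'))
    have e3 : -(i + j) - 0 = -i - j := by abel
    rw [e1] at c2
    rw [e3] at c5
    rw [show -i - -i = (0 : G) by abel] at c3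
    rw [show -0 - j = -j by abel] at c4
    simp only [hM, e1, e2]
    have := hx i; have := hx (i + j); have := hy j; have := hy (-i); have := hz (-j)
    have := hz (-i - j)
    simp only [Set.mem_Icc] at *
    apply one_sub_le_tent_add_tent <;> linarith
  rw [sum_sub_distrib, sum_add_distrib, sum_add_distrib, h1, h2, h3, h4, sum_add_distrib, hsig]
    at key
  linarith

theorem four_mul_le_sum_tent {x y z : G → ℝ} (hn : 6 ≤ Fintype.card G)
    (hx : ∀ i, x i ∈ Set.Icc (0 : ℝ) 1) (hy : ∀ i, y i ∈ Set.Icc (0 : ℝ) 1)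
    (hz : ∀ i, z i ∈ Set.Icc (0 : ℝ) 1) (hx0 : x 0 = 0) (hy0 : y 0 = 0) (hz0 : z 0 = 0)
    (h : ∀ i j, i ≠ 0 ∨ j ≠ 0 → 1 ≤ x i + y j + z (-i - j))
    {μ : ℝ} (hμ0 : 1 ≤ μ) (hμ2 : μ ≤ 2) :
    4 * μ ≤ μ * (∑ i ∈ univ.erase 0, (x i + y (-i) - 1) + ∑ i ∈ univ.erase 0, (y i + z (-i) - 1) +
        ∑ i ∈ univ.erase 0, (z i + x (-i) - 1)) + ∑ t ∈ zeroSumTriples G,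
      min (x t.1 + y t.2 + z (-t.1 - t.2) - 1) (2 - (x t.1 + y t.2 + z (-t.1 - t.2) - 1)) := by
  have key := le_sum_tent_zeroSumTriples hx hy hz hx0 hy0 hz0 h
  set Z := ∑ i ∈ univ.erase 0, (x i + y (-i) - 1) + ∑ i ∈ univ.erase 0, (y i + z (-i) - 1) +
        ∑ i ∈ univ.erase 0, (z i + x (-i) - 1)
  have hN : 0 ≤ ∑ t ∈ zeroSumTriples G,
      min (x t.1 + y t.2 + z (-t.1 - t.2) - 1) (2 - (x t.1 + y t.2 + z (-t.1 - t.2) - 1)) := by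
    refine sum_nonneg fun t ht => ?_
    have c := h t.1 t.2 (Or.inl (mem_zeroSumTriples.1 ht).1)
    have := (hx t.1).2; have := (hy t.2).2; have := (hz (-t.1 - t.2)).2
    apply le_min <;> linarith
  set N := ∑ t ∈ zeroSumTriples G,
      min (x t.1 + y t.2 + z (-t.1 - t.2) - 1) (2 - (x t.1 + y t.2 + z (-t.1 - t.2) - 1))
  have hn' : (6 : ℝ) ≤ Fintype.card G := by exact_mod_cast hn
  rcases le_or_gt 4 Z with hZ | hZ
  · nlinarith
  · have h8 : 8 ≤ 2 * Z + N := by nlinarith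
    nlinarith

end Combinatorics

section Trigonometry

open Real

theorem sin_mul_tent_le_sin {Δ ρ : ℝ} (hΔ0 : 0 ≤ Δ) (hΔ : Δ ≤ π / 2) (h0 : 0 ≤ ρ) (h2 : ρ ≤ 2) :
    sin Δ * min ρ (2 - ρ) ≤ sin (Δ * ρ) := by
  have hs : 0 ≤ sin Δ := sin_nonneg_of_nonneg_of_le_pi hΔ0 (by linarith [pi_pos])
  have hmemΔ : Δ ∈ Set.Icc 0 π := ⟨hΔ0, by linarith [pi_pos]⟩
  have hcon := strictConcaveOn_sin_Icc.concaveOn.2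
  rcases le_total ρ 1 with h1 | h1
  · have := hcon (⟨le_rfl, pi_pos.le⟩ : (0 : ℝ) ∈ Set.Icc 0 π) hmemΔ (sub_nonneg.2 h1) h0 (by ring)
    simp only [smul_eq_mul, sin_zero, mul_zero, zero_add] at this
    rw [min_eq_left (by linarith), mul_comm Δ]
    linarith
  · have hs2 : 0 ≤ sin (2 * Δ) := sin_nonneg_of_nonneg_of_le_pi (by linarith) (by linarith)
    have := hcon hmemΔ (⟨by linarith, by linarith⟩ : 2 * Δ ∈ Set.Icc 0 π)
      (sub_nonneg.2 h2) (sub_nonneg.2 h1) (by ring)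
    simp only [smul_eq_mul] at this
    rw [show (2 - ρ) * Δ + (ρ - 1) * (2 * Δ) = Δ * ρ by ring] at this
    rw [min_eq_right (by linarith)]
    nlinarith [mul_nonneg (sub_nonneg.2 h1) hs2]

theorem sum_sum_sin_mul_nonneg {G : Type*} [AddCommGroup G] [Fintype G] [DecidableEq G]
    {x y z u v w : G → ℝ} (hn : 6 ≤ Fintype.card G)
    (hx : ∀ i, x i ∈ Set.Icc (0 : ℝ) 1) (hy : ∀ i, y i ∈ Set.Icc (0 : ℝ) 1)
    (hz : ∀ i, z i ∈ Set.Icc (0 : ℝ) 1) (hx0 : x 0 = 0) (hy0 : y 0 = 0) (hz0 : z 0 = 0)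
    (h : ∀ i j, i ≠ 0 ∨ j ≠ 0 → 1 ≤ x i + y j + z (-i - j))
    (hu : ∀ i, u i ∈ Set.Icc (1 : ℝ) 2) (hv : ∀ i, v i ∈ Set.Icc (1 : ℝ) 2)
    (hw : ∀ i, w i ∈ Set.Icc (1 : ℝ) 2) {Δ : ℝ} (hΔ0 : 0 ≤ Δ) (hΔ : Δ ≤ π / 2) :
    0 ≤ ∑ i, ∑ j, sin (Δ * (x i + y j + z (-i - j) - 1)) * (u i * v j * w (-i - j)) := by
  obtain ⟨μ, hμ1, hμ2, hμu, hμv, hμw, hμ⟩ : ∃ μ : ℝ, 1 ≤ μ ∧ μ ≤ 2 ∧ μ ≤ u 0 ∧ μ ≤ v 0 ∧ μ ≤ w 0 ∧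
      u 0 * v 0 * w 0 ≤ 4 * μ := by
    obtain ⟨hu1, hu2⟩ := hu 0
    obtain ⟨hv1, hv2⟩ := hv 0
    obtain ⟨hw1, hw2⟩ := hw 0
    have four : ∀ {a b : ℝ}, 1 ≤ a → a ≤ 2 → 1 ≤ b → b ≤ 2 → a * b ≤ 4 := by
      intros; nlinarith
    have huv := four hu1 hu2 hv1 hv2
    have huw := four hu1 hu2 hw1 hw2
    have hvw := four hv1 hv2 hw1 hw2
    refine ⟨min (u 0) (min (v 0) (w 0)), by simp [*], by simp [*], by simp, by simp, by simp, ?_⟩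
    rcases min_choice (u 0) (min (v 0) (w 0)) with h' | h' <;> rw [h']
    · nlinarith
    · rcases min_choice (v 0) (w 0) with h'' | h'' <;> rw [h''] <;> nlinarith
  have hs : 0 ≤ sin Δ := sin_nonneg_of_nonneg_of_le_pi hΔ0 (by linarith [pi_pos])
  have prod_ge : ∀ {m a b c : ℝ}, 1 ≤ m → m ≤ a → 1 ≤ b → 1 ≤ c → m ≤ a * b * c := by
    intro m a b c hm ha hb hc
    have hab : a ≤ a * b := le_mul_of_one_le_right (by linarith) hb
    exact ha.trans (hab.trans (le_mul_of_one_le_right (by linarith) hc))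
  have tent_nonneg : ∀ i j, i ≠ 0 ∨ j ≠ 0 →
      0 ≤ min (x i + y j + z (-i - j) - 1) (2 - (x i + y j + z (-i - j) - 1)) := by
    intro i j hij
    have := h i j hij; have := (hx i).2; have := (hy j).2; have := (hz (-i - j)).2
    apply le_min <;> linarith
  have tent_le_sin : ∀ i j, i ≠ 0 ∨ j ≠ 0 → ∀ m : ℝ, 0 ≤ m → m ≤ u i * v j * w (-i - j) →
      sin Δ * (m * min (x i + y j + z (-i - j) - 1) (2 - (x i + y j + z (-i - j) - 1))) ≤
        sin (Δ * (x i + y j + z (-i - j) - 1)) * (u i * v j * w (-i - j)) := by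
    intro i j hij m hm hmw
    have h1 := tent_nonneg i j hij
    have := h i j hij; have := (hx i).2; have := (hy j).2; have := (hz (-i - j)).2
    have h2 := sin_mul_tent_le_sin (ρ := x i + y j + z (-i - j) - 1) hΔ0 hΔ
      (by linarith) (by linarith)
    have h3 := mul_le_mul h2 hmw hm ((mul_nonneg hs h1).trans h2)
    linarith
  have tent_of_le : ∀ {r : ℝ}, r ≤ 1 → min r (2 - r) = r := fun hr => min_eq_left (by linarith)
  rw [sum_sum_eq_add_sum_zeroSumTriples]
  have hA : sin Δ * (μ * ∑ i ∈ univ.erase 0, (y i + z (-i) - 1)) ≤ ∑ i ∈ univ.erase (0 : G),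
      sin (Δ * (x 0 + y i + z (-0 - i) - 1)) * (u 0 * v i * w (-0 - i)) := by
    rw [mul_sum, mul_sum]
    refine sum_le_sum fun i hi => ?_
    have := tent_le_sin 0 i (Or.inr (ne_of_mem_erase hi)) μ (by linarith)
      (prod_ge hμ1 hμu (hv _).1 (hw _).1)
    rw [tent_of_le (by have := (hy i).2; have := (hz (-0 - i)).2; linarith)] at this
    refine le_of_eq_of_le ?_ this
    simp [hx0]
  have hB : sin Δ * (μ * ∑ i ∈ univ.erase 0, (z i + x (-i) - 1)) ≤ ∑ i ∈ univ.erase (0 : G),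
      sin (Δ * (x i + y 0 + z (-i - 0) - 1)) * (u i * v 0 * w (-i - 0)) := by
    have hneg : ∑ i ∈ univ.erase 0, (z i + x (-i) - 1) =
        ∑ i ∈ univ.erase 0, (z (-i) + x i - 1) :=
      sum_nbij' (fun i => -i) (fun i => -i) (by simp) (by simp) (by simp) (by simp) (by simp)
    rw [hneg, mul_sum, mul_sum]
    refine sum_le_sum fun i hi => ?_
    have := tent_le_sin i 0 (Or.inl (ne_of_mem_erase hi)) μ (by linarith)
      ((prod_ge hμ1 hμv (hu i).1 (hw (-i - 0)).1).trans_eq (by ring))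
    rw [tent_of_le (by have := (hx i).2; have := (hz (-i - 0)).2; linarith)] at this
    refine le_of_eq_of_le ?_ this
    simp [hy0, add_comm]
  have hC : sin Δ * (μ * ∑ i ∈ univ.erase 0, (x i + y (-i) - 1)) ≤ ∑ i ∈ univ.erase (0 : G),
      sin (Δ * (x i + y (-i) + z (-i - -i) - 1)) * (u i * v (-i) * w (-i - -i)) := by
    rw [mul_sum, mul_sum]
    refine sum_le_sum fun i hi => ?_
    have e : -i - -i = 0 := by abel
    have := tent_le_sin i (-i) (Or.inl (ne_of_mem_erase hi)) μ (by linarith)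
      ((prod_ge hμ1 (hμw.trans_eq (by rw [e])) (hu i).1 (hv (-i)).1).trans_eq
        (by ring : w (-i - -i) * u i * v (-i) = _))
    rw [tent_of_le (by rw [e]; have := (hx i).2; have := (hy (-i)).2; linarith)] at this
    refine le_of_eq_of_le ?_ this
    simp [hz0]
  have hT : sin Δ * ∑ t ∈ zeroSumTriples G,
      min (x t.1 + y t.2 + z (-t.1 - t.2) - 1) (2 - (x t.1 + y t.2 + z (-t.1 - t.2) - 1)) ≤
      ∑ t ∈ zeroSumTriples G, sin (Δ * (x t.1 + y t.2 + z (-t.1 - t.2) - 1)) *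
        (u t.1 * v t.2 * w (-t.1 - t.2)) := by
    rw [mul_sum]
    refine sum_le_sum fun t ht => ?_
    have := tent_le_sin t.1 t.2 (Or.inl (mem_zeroSumTriples.1 ht).1) 1 zero_le_one
      (prod_ge le_rfl (hu _).1 (hv _).1 (hw _).1)
    rwa [one_mul] at this
  have h00 : sin (Δ * (x 0 + y 0 + z (-0 - 0) - 1)) * (u 0 * v 0 * w (-0 - 0)) =
      -(sin Δ * (u 0 * v 0 * w 0)) := by
    simp [hx0, hy0, hz0]
  have key := mul_le_mul_of_nonneg_left
    (four_mul_le_sum_tent hn hx hy hz hx0 hy0 hz0 h hμ1 hμ2) hs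
  have := mul_le_mul_of_nonneg_left hμ hs
  rw [h00]
  linarith

end Trigonometry

/-- The quantity `ab + bc + ca - (a + b + c) / 2` whose positivity is at stake. -/
noncomputable def pairExcess (a b c : ℝ) : ℝ := a * b + b * c + c * a - (a + b + c) / 2

theorem pairExcess_rotate (a b c : ℝ) : pairExcess b c a = pairExcess a b c := by
  unfold pairExcess; ring

theorem pairExcess_pos_mono_left {a a' b c : ℝ} (ha : 0 ≤ a) (ha' : a ≤ a')
    (hb : b ∈ Set.Icc (0 : ℝ) 1) (hc : c ∈ Set.Icc (0 : ℝ) 1) (h : 0 < pairExcess a b c) :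
    0 < pairExcess a' b c := by
  obtain ⟨hb0, hb1⟩ := hb
  obtain ⟨hc0, hc1⟩ := hc
  unfold pairExcess at *
  have hbc : 1 / 2 ≤ b + c := by
    by_contra! hlt
    nlinarith [mul_nonneg ha (sub_nonneg.2 hlt.le), mul_nonneg hb0 (sub_nonneg.2 hlt.le),
      mul_nonneg hc0 (sub_nonneg.2 hlt.le), mul_nonneg hb0 hb0, mul_nonneg hc0 hc0]
  nlinarith [mul_nonneg (sub_nonneg.2 ha') (sub_nonneg.2 hbc)]

theorem pairExcess_pos_mono {a b c a' b' c' : ℝ} (ha : 0 ≤ a) (hb : 0 ≤ b) (hc : 0 ≤ c)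
    (haa : a ≤ a') (hbb : b ≤ b') (hcc : c ≤ c') (ha1 : a' ≤ 1) (hb1 : b' ≤ 1) (hc1 : c' ≤ 1)
    (h : 0 < pairExcess a b c) : 0 < pairExcess a' b' c' := by
  have h1 := pairExcess_pos_mono_left ha haa ⟨hb, by linarith⟩ ⟨hc, by linarith⟩ h
  rw [← pairExcess_rotate] at h1 ⊢
  have h2 := pairExcess_pos_mono_left hb hbb ⟨hc, by linarith⟩ ⟨by linarith, ha1⟩ h1
  rw [← pairExcess_rotate] at h2 ⊢
  exact pairExcess_pos_mono_left hc hcc ⟨by linarith, ha1⟩ ⟨by linarith, hb1⟩ h2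

section Angles

open Real

/-- The parametrisation of `[0, 1]` by angles in `[-π/6, π/3]`. -/
noncomputable def angleValue (α : ℝ) : ℝ := (1 + √3 * tan α) / 4

theorem pairExcess_angleValue {α β γ : ℝ} (hα : cos α ≠ 0) (hβ : cos β ≠ 0) (hγ : cos γ ≠ 0) :
    pairExcess (angleValue α) (angleValue β) (angleValue γ) =
      -(3 / 16) * (cos (α + β + γ) * (1 / cos α * (1 / cos β) * (1 / cos γ))) := by
  have h3 : √3 ^ 2 = 3 := sq_sqrt (by norm_num)
  have key : cos (α + β + γ) * (1 / cos α * (1 / cos β) * (1 / cos γ)) =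
      1 - (tan α * tan β + tan β * tan γ + tan γ * tan α) := by
    rw [cos_add, cos_add, sin_add, tan_eq_sin_div_cos, tan_eq_sin_div_cos, tan_eq_sin_div_cos]
    field_simp
    ring
  rw [key]
  unfold pairExcess angleValue
  linear_combination (tan α * tan β + tan β * tan γ + tan γ * tan α) / 16 * h3

theorem exists_angleValue_eq {a : ℝ} (ha : a ∈ Set.Icc (0 : ℝ) 1) :
    ∃ α ∈ Set.Icc (-(π / 6)) (π / 3), angleValue α = a := by
  have h3 : √3 * √3 = 3 := mul_self_sqrt (by norm_num)
  have h3pos : 0 < √3 := by positivity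
  refine ⟨arctan ((4 * a - 1) / √3), ⟨?_, ?_⟩, ?_⟩
  · rw [← arctan_tan (x := -(π / 6)) (by linarith [pi_pos]) (by linarith [pi_pos]), tan_neg,
      tan_pi_div_six]
    apply arctan_strictMono.monotone
    rw [← neg_div]
    gcongr
    linarith [ha.1]
  · rw [← arctan_tan (x := π / 3) (by linarith [pi_pos]) (by linarith [pi_pos]), tan_pi_div_three]
    apply arctan_strictMono.monotone
    rw [div_le_iff₀ h3pos, h3]
    linarith [ha.2]
  · rw [angleValue, tan_arctan]
    field_simp
    ring

theorem angleValue_mono {α β : ℝ} (hα : -(π / 6) ≤ α) (hβ : β ≤ π / 3) (h : α ≤ β) :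
    angleValue α ≤ angleValue β := by
  unfold angleValue
  have : tan α ≤ tan β := strictMonoOn_tan.monotoneOn ⟨by linarith [pi_pos], by linarith [pi_pos]⟩
    ⟨by linarith [pi_pos], by linarith [pi_pos]⟩ h
  gcongr

theorem le_of_angleValue_le {α β : ℝ} (hα : α ≤ π / 3) (hβ : -(π / 6) ≤ β)
    (h : angleValue α ≤ angleValue β) : α ≤ β := by
  by_contra! hlt
  have : tan β < tan α := strictMonoOn_tan ⟨by linarith [pi_pos], by linarith [pi_pos]⟩
    ⟨by linarith [pi_pos], by linarith [pi_pos]⟩ hlt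
  unfold angleValue at h
  have h3pos : 0 < √3 := by positivity
  nlinarith

theorem half_le_cos {α : ℝ} (hα : α ∈ Set.Icc (-(π / 6)) (π / 3)) : 1 / 2 ≤ cos α := by
  rw [← cos_pi_div_three, ← cos_abs α]
  refine cos_le_cos_of_nonneg_of_le_pi (abs_nonneg α) (by linarith [pi_pos]) ?_
  exact abs_le.2 ⟨by linarith [pi_pos, hα.1], hα.2⟩

theorem one_div_cos_mem {α : ℝ} (hα : α ∈ Set.Icc (-(π / 6)) (π / 3)) :
    1 / cos α ∈ Set.Icc (1 : ℝ) 2 := by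
  have h := half_le_cos hα
  have hpos : 0 < cos α := by linarith
  refine ⟨?_, ?_⟩
  · rw [le_div_iff₀ hpos, one_mul]; exact cos_le_one α
  · rw [div_le_iff₀ hpos]; linarith

theorem pairExcess_angleValue_pos_iff {α β γ : ℝ} (hα : α ∈ Set.Icc (-(π / 6)) (π / 3))
    (hβ : β ∈ Set.Icc (-(π / 6)) (π / 3)) (hγ : γ ∈ Set.Icc (-(π / 6)) (π / 3)) :
    0 < pairExcess (angleValue α) (angleValue β) (angleValue γ) ↔ π / 2 < α + β + γ := by
  have h1 := half_le_cos hα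
  have h2 := half_le_cos hβ
  have h3 := half_le_cos hγ
  have hα' : 0 < cos α := by linarith
  have hβ' : 0 < cos β := by linarith
  have hγ' : 0 < cos γ := by linarith
  have hp : 0 < 1 / cos α * (1 / cos β) * (1 / cos γ) := by positivity
  rw [pairExcess_angleValue hα'.ne' hβ'.ne' hγ'.ne']
  constructor
  · intro h
    by_contra! hle
    have : 0 ≤ cos (α + β + γ) :=
      cos_nonneg_of_mem_Icc ⟨by linarith [hα.1, hβ.1, hγ.1], hle⟩
    nlinarith [mul_nonneg this hp.le]
  · intro h
    have : cos (α + β + γ) < 0 :=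
      cos_neg_of_pi_div_two_lt_of_lt h (by linarith [hα.2, hβ.2, hγ.2, pi_pos])
    nlinarith [mul_pos_of_neg_of_neg this (neg_neg_of_pos hp)]

end Angles

/-- The mean of a real function on a finite type. -/
noncomputable def mean {ι : Type*} [Fintype ι] (f : ι → ℝ) : ℝ := (∑ i, f i) / Fintype.card ι

theorem mean_le_mean {ι : Type*} [Fintype ι] {f g : ι → ℝ} (h : ∀ i, f i ≤ g i) :
    mean f ≤ mean g := by
  unfold mean
  gcongr with i
  exact h i

theorem mean_const {ι : Type*} [Fintype ι] [Nonempty ι] (r : ℝ) : mean (fun _ : ι => r) = r := by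
  simp [mean]

theorem mean_mem_Icc {ι : Type*} [Fintype ι] [Nonempty ι] {f : ι → ℝ}
    (h : ∀ i, f i ∈ Set.Icc (0 : ℝ) 1) : mean f ∈ Set.Icc (0 : ℝ) 1 :=
  ⟨(mean_const (ι := ι) 0).symm.trans_le (mean_le_mean fun i => (h i).1),
    (mean_le_mean fun i => (h i).2).trans_eq (mean_const (ι := ι) 1)⟩

theorem mean_comp_equiv {ι κ : Type*} [Fintype ι] [Fintype κ] (e : ι ≃ κ) (f : κ → ℝ) :
    mean (fun i => f (e i)) = mean f := by
  unfold mean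
  rw [e.sum_comp f, Fintype.card_congr e]

theorem mean_prod {ι κ : Type*} [Fintype ι] [Fintype κ] (f : ι × κ → ℝ) :
    mean f = mean fun i => mean fun j => f (i, j) := by
  unfold mean
  rw [Fintype.sum_prod_type, Fintype.card_prod, ← sum_div, div_div]
  push_cast
  rw [mul_comm]

theorem sum_sum_pairExcess {G : Type*} [AddCommGroup G] [Fintype G] (a b c : G → ℝ) :
    ∑ i, ∑ j, pairExcess (a i) (b j) (c (-i - j)) =
      (Fintype.card G : ℝ) ^ 2 * pairExcess (mean a) (mean b) (mean c) := by
  have hcard : (Fintype.card G : ℝ) ≠ 0 := by simp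
  have inner (i : G) (F : G → ℝ) : ∑ j, F (-i - j) = ∑ j, F j := (Equiv.subLeft (-i)).sum_comp F
  have h1 : ∑ i, ∑ j, a i * b j = (∑ i, a i) * ∑ j, b j := (sum_mul_sum _ _ _ _).symm
  have h3 : ∑ i, ∑ j, c (-i - j) * a i = (∑ i, c i) * ∑ i, a i := by
    rw [mul_comm, sum_mul_sum]
    refine sum_congr rfl fun i _ => ?_
    rw [← mul_sum, ← sum_mul, inner, mul_comm]
  have h2 : ∑ i, ∑ j, b j * c (-i - j) = (∑ i, b i) * ∑ i, c i := by
    rw [sum_comm, sum_mul_sum]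
    refine sum_congr rfl fun j _ => ?_
    rw [← mul_sum, ← mul_sum, ← inner j c]
    congr 1
    refine sum_congr rfl fun i _ => ?_
    congr 1
    abel
  have h4 : ∑ i, ∑ j, (a i + b j + c (-i - j)) / 2 =
      Fintype.card G * (∑ i, a i + ∑ i, b i + ∑ i, c i) / 2 := by
    simp only [← sum_div, sum_add_distrib, inner, sum_const, card_univ, nsmul_eq_mul, ← mul_sum]
    ring
  simp only [pairExcess, sum_sub_distrib, sum_add_distrib, h1, h2, h3, h4]
  unfold mean
  field_simp

open Real in
theorem pairExcess_mean_nonpos {G : Type*} [AddCommGroup G] [Fintype G]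
    (hn : 6 ≤ Fintype.card G) {a b c : G → ℝ}
    (ha : ∀ i, a i ∈ Set.Icc (0 : ℝ) 1) (hb : ∀ i, b i ∈ Set.Icc (0 : ℝ) 1)
    (hc : ∀ i, c i ∈ Set.Icc (0 : ℝ) 1) (ha0 : ∀ i, a i ≤ a 0) (hb0 : ∀ i, b i ≤ b 0)
    (hc0 : ∀ i, c i ≤ c 0)
    (h : ∀ i j, i ≠ 0 ∨ j ≠ 0 → pairExcess (a i) (b j) (c (-i - j)) ≤ 0) :
    pairExcess (mean a) (mean b) (mean c) ≤ 0 := by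
  classical
  by_contra! hpos
  choose α hα hαa using fun i => exists_angleValue_eq (ha i)
  choose β hβ hβb using fun i => exists_angleValue_eq (hb i)
  choose γ hγ hγc using fun i => exists_angleValue_eq (hc i)
  have mean_le {f : G → ℝ} {r : ℝ} (hf : ∀ i, f i ≤ r) : mean f ≤ r :=
    (mean_le_mean hf).trans_eq (mean_const r)
  have htop : 0 < pairExcess (a 0) (b 0) (c 0) :=
    pairExcess_pos_mono (mean_mem_Icc ha).1 (mean_mem_Icc hb).1 (mean_mem_Icc hc).1
      (mean_le ha0) (mean_le hb0) (mean_le hc0) (ha 0).2 (hb 0).2 (hc 0).2 hpos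
  rw [← hαa, ← hβb, ← hγc, pairExcess_angleValue_pos_iff (hα 0) (hβ 0) (hγ 0)] at htop
  obtain ⟨Δ, hΔ⟩ : ∃ Δ, Δ = α 0 + β 0 + γ 0 - π / 2 := ⟨_, rfl⟩
  have hΔ0 : 0 < Δ := by linarith
  have hΔ2 : Δ ≤ π / 2 := by linarith [(hα 0).2, (hβ 0).2, (hγ 0).2]
  have gap_mem {δ : G → ℝ} (hδ : ∀ i, δ i ≤ δ 0) (i : G) :
      min 1 ((δ 0 - δ i) / Δ) ∈ Set.Icc (0 : ℝ) 1 :=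
    ⟨le_min zero_le_one (div_nonneg (sub_nonneg.2 (hδ i)) hΔ0.le), min_le_left _ _⟩
  have gap_zero (δ : G → ℝ) : min 1 ((δ 0 - δ 0) / Δ) = 0 := by simp
  have le_clip {δ : G → ℝ} (i : G) : δ i ≤ δ 0 - Δ * min 1 ((δ 0 - δ i) / Δ) := by
    have := mul_le_mul_of_nonneg_left (min_le_right 1 ((δ 0 - δ i) / Δ)) hΔ0.le
    rw [mul_div_cancel₀ _ hΔ0.ne'] at this
    linarith
  have clip_mem {δ : G → ℝ} (hδ : ∀ i, δ i ≤ δ 0) (hm : ∀ i, δ i ∈ Set.Icc (-(π / 6)) (π / 3))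
      (i : G) : δ 0 - Δ * min 1 ((δ 0 - δ i) / Δ) ∈ Set.Icc (-(π / 6)) (π / 3) :=
    ⟨(hm i).1.trans (le_clip i),
      (sub_le_self _ (mul_nonneg hΔ0.le (gap_mem hδ i).1)).trans (hm 0).2⟩
  have hα0 (i : G) : α i ≤ α 0 := le_of_angleValue_le (hα i).2 (hα 0).1 (by simpa [hαa] using ha0 i)
  have hβ0 (i : G) : β i ≤ β 0 := le_of_angleValue_le (hβ i).2 (hβ 0).1 (by simpa [hβb] using hb0 i)
  have hγ0 (i : G) : γ i ≤ γ 0 := le_of_angleValue_le (hγ i).2 (hγ 0).1 (by simpa [hγc] using hc0 i)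
  have hgap : ∀ i j, i ≠ 0 ∨ j ≠ 0 → 1 ≤ min 1 ((α 0 - α i) / Δ) + min 1 ((β 0 - β j) / Δ) +
      min 1 ((γ 0 - γ (-i - j)) / Δ) := by
    intro i j hij
    have hx := (gap_mem hα0 i).1
    have hy := (gap_mem hβ0 j).1
    have hz := (gap_mem hγ0 (-i - j)).1
    have hle : α i + β j + γ (-i - j) ≤ π / 2 := by
      have := h i j hij
      rw [← hαa, ← hβb, ← hγc] at this
      exact not_lt.1 fun h' =>
        this.not_gt ((pairExcess_angleValue_pos_iff (hα _) (hβ _) (hγ _)).2 h')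
    rcases min_choice 1 ((α 0 - α i) / Δ) with h1 | h1
    · linarith
    rcases min_choice 1 ((β 0 - β j) / Δ) with h2 | h2
    · linarith
    rcases min_choice 1 ((γ 0 - γ (-i - j)) / Δ) with h3 | h3
    · linarith
    rw [h1, h2, h3, ← add_div, ← add_div, le_div_iff₀ hΔ0]
    linarith
  have hnonneg := sum_sum_sin_mul_nonneg hn (gap_mem hα0) (gap_mem hβ0) (gap_mem hγ0)
    (gap_zero α) (gap_zero β) (gap_zero γ) hgap
    (fun i => one_div_cos_mem (clip_mem hα0 hα i)) (fun i => one_div_cos_mem (clip_mem hβ0 hβ i))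
    (fun i => one_div_cos_mem (clip_mem hγ0 hγ i)) hΔ0.le hΔ2
  have val_mono {δ : G → ℝ} {d : G → ℝ} (hδ : ∀ i, δ i ≤ δ 0)
      (hm : ∀ i, δ i ∈ Set.Icc (-(π / 6)) (π / 3)) (hd : ∀ i, angleValue (δ i) = d i) (i : G) :
      d i ≤ angleValue (δ 0 - Δ * min 1 ((δ 0 - δ i) / Δ)) :=
    (hd i).symm.trans_le (angleValue_mono (hm i).1 (clip_mem hδ hm i).2 (le_clip i))
  have val_le {δ : G → ℝ} {d : G → ℝ} (hδ : ∀ i, δ i ≤ δ 0)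
      (hm : ∀ i, δ i ∈ Set.Icc (-(π / 6)) (π / 3)) (hd : ∀ i, angleValue (δ i) = d i)
      (h1 : d 0 ≤ 1) (i : G) : angleValue (δ 0 - Δ * min 1 ((δ 0 - δ i) / Δ)) ≤ 1 :=
    (angleValue_mono (clip_mem hδ hm i).1 (hm 0).2
      (sub_le_self _ (mul_nonneg hΔ0.le (gap_mem hδ i).1))).trans ((hd 0).trans_le h1)
  have hpos' := pairExcess_pos_mono (mean_mem_Icc ha).1 (mean_mem_Icc hb).1 (mean_mem_Icc hc).1
    (mean_le_mean (val_mono hα0 hα hαa)) (mean_le_mean (val_mono hβ0 hβ hβb))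
    (mean_le_mean (val_mono hγ0 hγ hγc)) (mean_le (val_le hα0 hα hαa (ha 0).2))
    (mean_le (val_le hβ0 hβ hβb (hb 0).2)) (mean_le (val_le hγ0 hγ hγc (hc 0).2)) hpos
  have hsum := mul_pos (pow_pos (show (0 : ℝ) < Fintype.card G by positivity) 2) hpos'
  rw [← sum_sum_pairExcess] at hsum
  refine absurd hsum (not_lt.2 ?_)
  have hterm : ∀ i j,
      pairExcess (angleValue (α 0 - Δ * min 1 ((α 0 - α i) / Δ)))
        (angleValue (β 0 - Δ * min 1 ((β 0 - β j) / Δ)))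
        (angleValue (γ 0 - Δ * min 1 ((γ 0 - γ (-i - j)) / Δ))) = -(3 / 16) *
      (sin (Δ * (min 1 ((α 0 - α i) / Δ) + min 1 ((β 0 - β j) / Δ) +
        min 1 ((γ 0 - γ (-i - j)) / Δ) - 1)) *
      (1 / cos (α 0 - Δ * min 1 ((α 0 - α i) / Δ)) * (1 / cos (β 0 - Δ * min 1 ((β 0 - β j) / Δ))) *
        (1 / cos (γ 0 - Δ * min 1 ((γ 0 - γ (-i - j)) / Δ))))) := by
    intro i j
    have ne {δ : ℝ} (hδ : δ ∈ Set.Icc (-(π / 6)) (π / 3)) : cos δ ≠ 0 := by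
      have := half_le_cos hδ
      linarith
    rw [pairExcess_angleValue (ne (clip_mem hα0 hα i)) (ne (clip_mem hβ0 hβ j))
      (ne (clip_mem hγ0 hγ _)), ← cos_pi_div_two_sub]
    congr 3
    linear_combination -hΔ
  simp only [hterm, ← mul_sum]
  linarith

theorem exists_equiv_fin_antitone {ι : Type*} [Fintype ι] {n : ℕ} (hn : Fintype.card ι = n)
    (f : ι → ℝ) : ∃ e : Fin n ≃ ι, Antitone fun i => f (e i) := by
  let e := (Fintype.equivFinOfCardEq hn).symm
  refine ⟨(Tuple.sort fun i => -f (e i)).trans e, fun i j hij => ?_⟩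
  have := Tuple.monotone_sort (fun i => -f (e i)) hij
  simpa using this

open scoped Pointwise in
theorem exists_add_add_eq_of_card_le {p : ℕ} [Fact p.Prime] {S T U : Finset (ZMod p)}
    (hS : S.Nonempty) (hT : T.Nonempty) (hU : U.Nonempty) (h : p + 2 ≤ #S + #T + #U)
    (x : ZMod p) : ∃ s ∈ S, ∃ t ∈ T, ∃ u ∈ U, x = s + t + u := by
  have hp : p.Prime := Fact.out
  have h1 := ZMod.cauchy_davenport hp hS hT
  have h2 := ZMod.cauchy_davenport hp (hS.add hT) hU
  have hcard : Fintype.card (ZMod p) ≤ #(S + T + U) := by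
    rw [ZMod.card]
    have := hU.card_pos
    omega
  have huniv : S + T + U = univ := (card_eq_iff_eq_univ _).1 (le_antisymm (card_le_univ _) hcard)
  have hx : x ∈ S + T + U := huniv ▸ mem_univ x
  obtain ⟨_, hst, u, hu, rfl⟩ := mem_add.1 hx
  obtain ⟨s, hs, t, ht, rfl⟩ := mem_add.1 hst
  exact ⟨s, hs, t, ht, u, hu, rfl⟩

/-- Every element of `R` is a sum of three units at which three given `[0, 1]`-valued functions
have positive `pairExcess`, as soon as the means of these functions do. -/
def HasUnitRepresentations (R : Type*) [CommRing R] [Fintype Rˣ] : Prop :=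
  ∀ f g h : Rˣ → ℝ, (∀ a, f a ∈ Set.Icc (0 : ℝ) 1) → (∀ a, g a ∈ Set.Icc (0 : ℝ) 1) →
    (∀ a, h a ∈ Set.Icc (0 : ℝ) 1) → 0 < pairExcess (mean f) (mean g) (mean h) →
    ∀ x : R, ∃ a b c : Rˣ, x = a + b + c ∧ 0 < pairExcess (f a) (g b) (h c)

theorem hasUnitRepresentations_zmod_prime {p : ℕ} (hp : p.Prime) (hp7 : 7 ≤ p)
    [Fintype (ZMod p)ˣ] : HasUnitRepresentations (ZMod p) := by
  intro f g h hf hg hh hpos x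
  have : Fact p.Prime := ⟨hp⟩
  obtain ⟨n, hn⟩ : ∃ n, n = p - 1 := ⟨_, rfl⟩
  have hcard : Fintype.card (ZMod p)ˣ = n := by rw [hn, ← ZMod.card_units p]; congr!
  have : NeZero n := ⟨by omega⟩
  obtain ⟨e₁, he₁⟩ := exists_equiv_fin_antitone hcard f
  obtain ⟨e₂, he₂⟩ := exists_equiv_fin_antitone hcard g
  obtain ⟨e₃, he₃⟩ := exists_equiv_fin_antitone hcard h
  by_contra! hnone
  rw [← mean_comp_equiv e₁ f, ← mean_comp_equiv e₂ g, ← mean_comp_equiv e₃ h] at hpos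
  refine hpos.not_ge (pairExcess_mean_nonpos (by simp; omega) (fun i => hf _) (fun i => hg _)
    (fun i => hh _) (fun i => he₁ (Fin.zero_le i)) (fun i => he₂ (Fin.zero_le i))
    (fun i => he₃ (Fin.zero_le i)) fun i j hij => ?_)
  obtain ⟨k, hk⟩ : ∃ k, k = -i - j := ⟨_, rfl⟩
  rw [← hk]
  have hsum : n ≤ i.val + j.val + k.val := by
    have h0 : i + j + k = 0 := by rw [hk]; abel
    have hdvd : n ∣ i.val + j.val + k.val := by
      have := congrArg Fin.val h0
      rw [Fin.val_add, Fin.val_add, Nat.mod_add_mod] at this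
      exact Nat.dvd_of_mod_eq_zero (by simpa using this)
    refine Nat.le_of_dvd ?_ hdvd
    rcases hij with h' | h'
    · have := Fin.pos_iff_ne_zero.2 h'
      have : 0 < i.val := this
      omega
    · have := Fin.pos_iff_ne_zero.2 h'
      have : 0 < j.val := this
      omega
  let top (e : Fin n ≃ (ZMod p)ˣ) (i : Fin n) : Finset (ZMod p) :=
    (Finset.Iic i).map (e.toEmbedding.trans ⟨Units.val, Units.val_injective⟩)
  have top_card (e : Fin n ≃ (ZMod p)ˣ) (i : Fin n) : #(top e i) = i + 1 := by simp [top]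
  have top_nonempty (e : Fin n ≃ (ZMod p)ˣ) (i : Fin n) : (top e i).Nonempty := by simp [top]
  obtain ⟨s, hs, t, ht, u, hu, hx⟩ := exists_add_add_eq_of_card_le (top_nonempty e₁ i)
    (top_nonempty e₂ j) (top_nonempty e₃ k) (by rw [top_card, top_card, top_card]; omega) x
  simp only [top, mem_map, mem_Iic, Function.Embedding.trans_apply,
    Function.Embedding.coeFn_mk] at hs ht hu
  obtain ⟨i', hi', rfl⟩ := hs
  obtain ⟨j', hj', rfl⟩ := ht
  obtain ⟨k', hk', rfl⟩ := hu
  by_contra! hpos'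
  exact (hnone _ _ _ hx).not_gt (pairExcess_pos_mono (hf _).1 (hg _).1 (hh _).1 (he₁ hi') (he₂ hj')
    (he₃ hk') (hf _).2 (hg _).2 (hh _).2 hpos')

theorem hasUnitRepresentations_of_subsingleton (R : Type*) [CommRing R] [Fintype Rˣ]
    [Subsingleton R] : HasUnitRepresentations R := by
  intro f g h _ _ _ hpos x
  have mean_eq (f : Rˣ → ℝ) : mean f = f 1 := by
    rw [show f = fun _ => f 1 from funext fun a => congrArg f (Subsingleton.elim _ _), mean_const]
  rw [mean_eq, mean_eq, mean_eq] at hpos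
  exact ⟨1, 1, 1, Subsingleton.elim _ _, hpos⟩

theorem HasUnitRepresentations.of_ringEquiv {R S : Type*} [CommRing R] [CommRing S] [Fintype Rˣ]
    [Fintype Sˣ] (e : R ≃+* S) (hS : HasUnitRepresentations S) : HasUnitRepresentations R := by
  intro f g h hf hg hh hpos x
  let E : Sˣ ≃ Rˣ := (Units.mapEquiv e.symm.toMulEquiv).toEquiv
  rw [← mean_comp_equiv E f, ← mean_comp_equiv E g, ← mean_comp_equiv E h] at hpos
  obtain ⟨a, b, c, hx, habc⟩ :=
    hS _ _ _ (fun _ => hf _) (fun _ => hg _) (fun _ => hh _) hpos (e x)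
  refine ⟨E a, E b, E c, ?_, habc⟩
  apply e.injective
  simp [E, hx]

theorem HasUnitRepresentations.prod {R S : Type*} [CommRing R] [CommRing S] [Fintype Rˣ]
    [Fintype Sˣ] [Fintype (R × S)ˣ] (hR : HasUnitRepresentations R)
    (hS : HasUnitRepresentations S) : HasUnitRepresentations (R × S) := by
  intro f g h hf hg hh hpos x
  let E : Rˣ × Sˣ ≃ (R × S)ˣ := (MulEquiv.prodUnits (M := R) (N := S)).symm.toEquiv
  rw [← mean_comp_equiv E f, ← mean_comp_equiv E g, ← mean_comp_equiv E h, mean_prod, mean_prod,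
    mean_prod] at hpos
  obtain ⟨a, b, c, hx, habc⟩ := hR _ _ _ (fun _ => mean_mem_Icc fun _ => hf _)
    (fun _ => mean_mem_Icc fun _ => hg _) (fun _ => mean_mem_Icc fun _ => hh _) hpos x.1
  obtain ⟨a', b', c', hx', habc'⟩ :=
    hS _ _ _ (fun _ => hf _) (fun _ => hg _) (fun _ => hh _) habc x.2
  exact ⟨E (a, a'), E (b, b'), E (c, c'), Prod.ext hx hx', habc'⟩

theorem hasUnitRepresentations_zmod (m : ℕ) (hsf : Squarefree m) (hcop : m.Coprime 30) :
    ∀ [Fintype (ZMod m)ˣ], HasUnitRepresentations (ZMod m) := by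
  induction m using Nat.recOnPosPrimePosCoprime with
  | prime_pow p n hp hn =>
    have hn1 : n = 1 := by
      by_contra hne
      exact hp.not_isUnit (hsf p (sq p ▸ pow_dvd_pow p (by omega)))
    subst hn1
    rw [pow_one] at hcop ⊢
    intro _
    refine hasUnitRepresentations_zmod_prime hp ?_
    by_contra! hlt
    have := hp.two_le
    interval_cases p <;> revert hp hcop <;> decide
  | zero => exact absurd hsf (by simp)
  | one =>
    intro _
    exact hasUnitRepresentations_of_subsingleton _
  | coprime a b ha hb hab iha ihb =>
    have : NeZero a := ⟨by omega⟩
    have : NeZero b := ⟨by omega⟩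
    have : Fintype (ZMod a × ZMod b)ˣ := Fintype.ofEquiv _ MulEquiv.prodUnits.symm.toEquiv
    intro _
    exact .of_ringEquiv (ZMod.chineseRemainder hab)
      ((iha hsf.of_mul_left hcop.coprime_mul_right).prod
        (ihb hsf.of_mul_right hcop.coprime_mul_left))

theorem stmt_3 (m : ℕ) [NeZero m] (hodd : Odd m) (hsf : Squarefree m)
    (hcop : Nat.Coprime m 30) (f : (ZMod m)ˣ → ℝ)
    (hmem : ∀ a, f a ∈ Set.Icc (0 : ℝ) 1)
    (hsum : (Nat.totient m : ℝ) / 2 < ∑ a : (ZMod m)ˣ, f a) :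
    ∀ x : ZMod m, ∃ a₁ a₂ a₃ : (ZMod m)ˣ,
      x = (a₁ : ZMod m) + (a₂ : ZMod m) + (a₃ : ZMod m) ∧
      (1 / 2) * (f a₁ + f a₂ + f a₃) <
        f a₁ * f a₂ + f a₂ * f a₃ + f a₃ * f a₁ := by
  intro x
  have hmean : 1 / 2 < mean f := by
    rw [mean, ZMod.card_units_eq_totient, lt_div_iff₀ (by simp [NeZero.pos])]
    linarith
  obtain ⟨a, b, c, hx, habc⟩ := hasUnitRepresentations_zmod m hsf hcop f f f hmem hmem hmem
    (by unfold pairExcess; nlinarith) x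
  refine ⟨a, b, c, hx, ?_⟩
  unfold pairExcess at habc
  linarith
end

section
/- Let m be an odd squarefree integer divisible by 3, and let f : (ℤ/mℤ)* → [0,1] be supported on reduced residue classes congruent to 1 mod 3, with ∑_{a ∈ (ℤ/mℤ)*} f(a) > φ(m)/4. Then for any x ∈ ℤ/mℤ with x ≡ 0 (mod 3), there exist units a₁, a₂, a₃ with x = a₁ + a₂ + a₃, f(aᵢ) > 0 for each i, and f(a₁) + f(a₂) + f(a₃) > 3/2. -/
/-- This quantity is positive precisely when `(a * b + b * c + c * a) / (a + b + c)` exceeds `1 / 2`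
(for nonnegative entries, not all zero). It is affine in each variable, so it averages well over
product groups. -/
noncomputable def excess (a b c : ℝ) : ℝ := a * b + b * c + c * a - (a + b + c) / 2

lemma linear_ge_of_endpoints {L s t l u x : ℝ} (hl : L ≤ s * l + t) (hu : L ≤ s * u + t)
    (hlx : l ≤ x) (hxu : x ≤ u) : L ≤ s * x + t := by
  rcases le_total 0 s with hs | hs
  · nlinarith
  · nlinarith

lemma vertex_two {M α β γ : ℝ} (hM : 5 ≤ M) (hα : 0 ≤ α) (hβ : 0 ≤ β) (hγ : 0 ≤ γ)
    (hα4 : α ≤ 4) (hβ4 : β ≤ 4) :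
    6 * (α + β + γ) ≤ 2 * M * (α + β + M * γ) - (α * β + β * (M * γ) + M * γ * α) := by
  have h1 : 0 ≤ γ * (2 * M * M - M * (α + β) - 6) := by
    apply mul_nonneg hγ
    nlinarith
  have h2 : 0 ≤ (α + β) * (M - 5) := mul_nonneg (by linarith) (by linarith)
  nlinarith [mul_nonneg hα (sub_nonneg.2 hβ4), mul_nonneg hβ (sub_nonneg.2 hα4)]

lemma vertex_one {M α β γ E : ℝ} (hM : 5 ≤ M) (hα : 0 ≤ α) (hβ : 0 ≤ β) (hγ : 0 ≤ γ)
    (hα4 : α ≤ 4) (hE6 : E ≤ 6 * (α + β + γ))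
    (hE : E ≤ M * M * (2 * (α + β + γ) - (α * β + β * γ + γ * α))) :
    E ≤ 2 * M * (α + M * β + M * γ) - (α * (M * β) + M * β * (M * γ) + M * γ * α) := by
  rcases le_total 2 (β + γ) with h | h
  · have : 0 ≤ M * (M - 1) * (α * (β + γ - 2)) :=
      mul_nonneg (mul_nonneg (by linarith) (by linarith)) (mul_nonneg hα (by linarith))
    nlinarith
  · have hw : 0 ≤ 2 * (β + γ) - β * γ - 3 / 2 * (β + γ) := by nlinarith [sq_nonneg (β - γ)]
    have h1 : 0 ≤ (M * M - 25) * (2 * (β + γ) - β * γ) :=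
      mul_nonneg (by nlinarith) (by nlinarith)
    have h2 : 0 ≤ (M - 5) * (α * (2 - (β + γ))) :=
      mul_nonneg (by linarith) (mul_nonneg hα (by linarith))
    nlinarith [mul_nonneg (sub_nonneg.2 hα4) (add_nonneg hβ hγ)]

lemma mul_le_of_denominators {h α β γ u v : ℝ} (hσ : 132 / 25 < α + β + γ)
    (hγ : 0 ≤ γ) (hu0 : 0 ≤ u) (hv0 : 0 ≤ v) (hu4 : u ≤ 4) (hv4 : v ≤ 4)
    (hu : u * (β + γ - 2) ≤ h) (hv : v * (α + γ - 2) ≤ h) : u * v ≤ 22 / 3 * h := by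
  rcases le_total (28 / 11) (β + γ) with h1 | h1
  · nlinarith [mul_nonneg hu0 (sub_nonneg.2 hv4), mul_nonneg hu0 (sub_nonneg.2 h1)]
  · have h2 : 28 / 11 ≤ α + γ := by linarith
    nlinarith [mul_nonneg hv0 (sub_nonneg.2 hu4), mul_nonneg hv0 (sub_nonneg.2 h2)]

lemma head_le {P R γ : ℝ} (hP : 0 ≤ P) (hR : 0 ≤ R) (hγ : 0 ≤ γ) (hP4 : P ≤ 4) (hR4 : R ≤ 4) :
    P * R + R * γ + γ * P - 2 * (P + R + γ) ≤ 6 * γ := by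
  nlinarith [mul_nonneg hP (sub_nonneg.2 hR4), mul_nonneg hR (sub_nonneg.2 hP4),
    mul_nonneg hγ (sub_nonneg.2 hR4), mul_nonneg hγ (sub_nonneg.2 hP4)]

lemma heads_le_tails {P R S α β γ : ℝ} (hα : 0 ≤ α) (hβ : 0 ≤ β) (hγ : 0 ≤ γ)
    (hP : α ≤ P) (hR : β ≤ R) (hS : γ ≤ S) (hP4 : P ≤ 4) (hR4 : R ≤ 4) (hS4 : S ≤ 4)
    (h1 : P * β + β * γ + γ * P ≤ 2 * (P + β + γ))
    (h2 : α * R + R * γ + γ * α ≤ 2 * (α + R + γ))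
    (h3 : α * β + β * S + S * α ≤ 2 * (α + β + S)) :
    (P * R + R * γ + γ * P - 2 * (P + R + γ)) + (P * β + β * S + S * P - 2 * (P + β + S)) +
      (α * R + R * S + S * α - 2 * (α + R + S)) ≤
      25 * (2 * (α + β + γ) - (α * β + β * γ + γ * α)) := by
  rcases le_or_gt (α + β + γ) (132 / 25) with hσ | hσ
  · have e1 := head_le (hα.trans hP) (hβ.trans hR) hγ hP4 hR4
    have e2 := head_le (hα.trans hP) (hγ.trans hS) hβ hP4 hS4
    have e3 := head_le (hβ.trans hR) (hγ.trans hS) hα hR4 hS4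
    nlinarith [sq_nonneg (α - β), sq_nonneg (β - γ), sq_nonneg (α - γ),
      mul_nonneg (add_nonneg (add_nonneg hα hβ) hγ) (sub_nonneg.2 hσ)]
  · have e1 := mul_le_of_denominators (h := 2 * (α + β + γ) - (α * β + β * γ + γ * α))
      (u := P - α) (v := R - β) hσ hγ (by linarith) (by linarith) (by linarith)
      (by linarith) (by linarith) (by linarith)
    have e2 := mul_le_of_denominators (h := 2 * (α + β + γ) - (α * β + β * γ + γ * α))
      (α := β) (β := γ) (γ := α) (u := R - β) (v := S - γ) (by linarith) hα
      (by linarith) (by linarith) (by linarith)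
      (by linarith) (by linarith) (by linarith)
    have e3 := mul_le_of_denominators (h := 2 * (α + β + γ) - (α * β + β * γ + γ * α))
      (α := γ) (β := α) (γ := β) (u := S - γ) (v := P - α) (by linarith) hβ
      (by linarith) (by linarith) (by linarith)
      (by linarith) (by linarith) (by linarith)
    nlinarith

lemma heads_le_tail_sums {M P R S α β γ A B C : ℝ} (hM : 5 ≤ M)
    (hα : 0 ≤ α) (hβ : 0 ≤ β) (hγ : 0 ≤ γ)
    (hP : α ≤ P) (hR : β ≤ R) (hS : γ ≤ S) (hP4 : P ≤ 4) (hR4 : R ≤ 4) (hS4 : S ≤ 4)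
    (h1 : P * β + β * γ + γ * P ≤ 2 * (P + β + γ))
    (h2 : α * R + R * γ + γ * α ≤ 2 * (α + R + γ))
    (h3 : α * β + β * S + S * α ≤ 2 * (α + β + S))
    (h0 : α * β + β * γ + γ * α ≤ 2 * (α + β + γ))
    (hA : α ≤ A) (hA' : A ≤ M * α) (hB : β ≤ B) (hB' : B ≤ M * β)
    (hC : γ ≤ C) (hC' : C ≤ M * γ) :
    (P * R + R * γ + γ * P - 2 * (P + R + γ)) + (P * β + β * S + S * P - 2 * (P + β + S)) +
      (α * R + R * S + S * α - 2 * (α + R + S)) ≤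
      2 * M * (A + B + C) - (A * B + B * C + C * A) := by
  have hE25 := heads_le_tails hα hβ hγ hP hR hS hP4 hR4 hS4 h1 h2 h3
  have e1 := head_le (hα.trans hP) (hβ.trans hR) hγ hP4 hR4
  have e2 := head_le (hα.trans hP) (hγ.trans hS) hβ hP4 hS4
  have e3 := head_le (hβ.trans hR) (hγ.trans hS) hα hR4 hS4
  generalize (P * R + R * γ + γ * P - 2 * (P + R + γ)) = E₁ at *
  have hE6 : E₁ + (P * β + β * S + S * P - 2 * (P + β + S)) +
      (α * R + R * S + S * α - 2 * (α + R + S)) ≤ 6 * (α + β + γ) := by linarith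
  generalize E₁ + (P * β + β * S + S * P - 2 * (P + β + S)) +
      (α * R + R * S + S * α - 2 * (α + R + S)) = E at *
  have hα4 := hP.trans hP4
  have hβ4 := hR.trans hR4
  have hγ4 := hS.trans hS4
  have hE : E ≤ M * M * (2 * (α + β + γ) - (α * β + β * γ + γ * α)) := by
    nlinarith [mul_nonneg (show 0 ≤ M * M - 25 by nlinarith) (sub_nonneg.2 h0)]
  have v0 : E ≤ 2 * M * (α + β + γ) - (α * β + β * γ + γ * α) := by nlinarith
  have va := vertex_two hM hβ hγ hα hβ4 hγ4
  have vb := vertex_two hM hα hγ hβ hα4 hγ4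
  have vc := vertex_two hM hα hβ hγ hα4 hβ4
  have wa := vertex_one (E := E) hM hα hβ hγ hα4 (by linarith) (by linarith)
  have wb := vertex_one (E := E) hM hβ hα hγ hβ4 (by linarith) (by linarith)
  have wc := vertex_one (E := E) hM hγ hα hβ hγ4 (by linarith) (by linarith)
  have key : ∀ a b, (a = α ∨ a = M * α) → (b = β ∨ b = M * β) →
      E ≤ 2 * M * (a + b + C) - (a * b + b * C + C * a) := by
    intro a b ha hb
    have := linear_ge_of_endpoints (L := E) (s := 2 * M - a - b) (t := 2 * M * (a + b) - a * b)
      (l := γ) (u := M * γ) (x := C) ?_ ?_ hC hC'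
    · linarith
    · rcases ha with rfl | rfl <;> rcases hb with rfl | rfl <;> linarith
    · rcases ha with rfl | rfl <;> rcases hb with rfl | rfl <;> linarith
  have key2 : ∀ a, (a = α ∨ a = M * α) →
      E ≤ 2 * M * (a + B + C) - (a * B + B * C + C * a) := by
    intro a ha
    have := linear_ge_of_endpoints (L := E) (s := 2 * M - a - C) (t := 2 * M * (a + C) - a * C)
      (l := β) (u := M * β) (x := B) ?_ ?_ hB hB'
    · linarith
    · linarith [key a β ha (Or.inl rfl)]
    · linarith [key a (M * β) ha (Or.inr rfl)]
  have := linear_ge_of_endpoints (L := E) (s := 2 * M - B - C) (t := 2 * M * (B + C) - B * C)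
      (l := α) (u := M * α) (x := A) ?_ ?_ hA hA'
  · linarith
  · linarith [key2 α (Or.inl rfl)]
  · linarith [key2 (M * α) (Or.inr rfl)]

lemma ends_le {p a w u : ℝ} (hp : 1 < p) (ha : 1 ≤ a) (hau : a ≤ u)
    (hu : 3 + p ^ 2 ≤ (6 * p / (p + 1) - u) * (p + u))
    (hc : p * a + a * w + w * p ≤ 3) (hp3 : p ≤ 3) : p + a + w ≤ 6 * p / (p + 1) := by
  have h1 : 3 + p ^ 2 ≤ (6 * p / (p + 1) - 1) * (p + 1) := by
    rw [sub_mul, div_mul_cancel₀ _ (by linarith)]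
    nlinarith
  generalize 6 * p / (p + 1) = K at *
  have h2 := linear_ge_of_endpoints (L := 3 + p ^ 2) (s := K - p - (1 + u)) (t := K * p + u)
    (l := 1) (u := u) (x := a) (by linarith) (by linarith) ha hau
  have h3 : 3 + p ^ 2 ≤ (K - a) * (p + a) := by
    nlinarith [mul_nonneg (sub_nonneg.2 ha) (sub_nonneg.2 hau)]
  have h4 : (p + w) * (p + a) ≤ (K - a) * (p + a) := by nlinarith
  linarith [le_of_mul_le_mul_right h4 (by linarith)]

lemma add_mul_le {p t w : ℝ} (ht : t ≤ 1) (hw : w ≤ 1) (h : p * t + t * w + w * p ≤ 3) :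
    (t + w) * (p + 1) ≤ 4 := by
  nlinarith [mul_nonneg (sub_nonneg.2 ht) (sub_nonneg.2 hw)]

lemma sum_six_le {x0 x1 x2 x3 x4 x5 : ℝ} (h5 : -1 ≤ x5) (h45 : x5 ≤ x4) (h34 : x4 ≤ x3) (h23 : x3 ≤ x2)
    (h12 : x2 ≤ x1) (h01 : x1 ≤ x0) (h0 : x0 ≤ 3)
    (c015 : x0 * x1 + x1 * x5 + x5 * x0 ≤ 3)
    (c024 : x0 * x2 + x2 * x4 + x4 * x0 ≤ 3)
    (c033 : x0 * x3 + x3 * x3 + x3 * x0 ≤ 3)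
    (c114 : x1 * x1 + x1 * x4 + x4 * x1 ≤ 3)
    (c222 : x2 * x2 + x2 * x2 + x2 * x2 ≤ 3) :
    x0 + x1 + x2 + x3 + x4 + x5 ≤ 6 := by
  have hx2 : x2 ≤ 1 := by nlinarith
  rcases le_or_gt x0 1 with hp | hp
  · linarith
  have hx3 : x3 * (x0 + 1) ≤ 2 := by
    by_contra hcon
    push Not at hcon
    have : 0 < x3 := by nlinarith
    nlinarith [sq_nonneg (x0 - 1)]
  have hx24 : (x2 + x4) * (x0 + 1) ≤ 4 := add_mul_le hx2 (by linarith) c024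
  have hq : 0 < x0 + 1 := by linarith
  have hx234 : x2 + x3 + x4 ≤ 6 - 6 * x0 / (x0 + 1) := by
    have : 6 - 6 * x0 / (x0 + 1) = 6 / (x0 + 1) := by field_simp; ring
    rw [this, le_div_iff₀ hq]
    linarith
  rcases le_or_gt x1 1 with h1 | h1
  · have h15 := add_mul_le h1 (by linarith) c015
    refine le_of_mul_le_mul_right ?_ hq
    nlinarith [mul_nonneg (sub_nonneg.2 h0) (sub_nonneg.2 hp.le)]
  rcases le_or_gt x1 2 with h2 | h2
  · have : x0 + x1 + x5 ≤ 6 * x0 / (x0 + 1) := by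
      rcases le_or_gt x0 2 with hp2 | hp2
      · refine ends_le (u := x0) hp h1.le h01 ?_ c015 h0
        refine le_of_mul_le_mul_right ?_ hq
        have : (6 * x0 / (x0 + 1) - x0) * (x0 + x0) * (x0 + 1) =
          (6 * x0 - x0 * (x0 + 1)) * (x0 + x0) := by field_simp
        rw [this]
        linarith [mul_nonneg (mul_nonneg (sub_nonneg.2 hp2) (sub_nonneg.2 hp.le))
          (zero_lt_one.trans hp).le]
      · refine ends_le (u := 2) hp h1.le h2 ?_ c015 h0
        refine le_of_mul_le_mul_right ?_ hq
        have : (6 * x0 / (x0 + 1) - 2) * (x0 + 2) * (x0 + 1) =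
          (6 * x0 - 2 * (x0 + 1)) * (x0 + 2) := by field_simp
        rw [this]
        linarith [mul_nonneg (mul_nonneg (sub_nonneg.2 h0) (sub_nonneg.2 hp2.le))
          (show 0 ≤ x0 + 2 by linarith)]
    linarith
  · have h14 : x1 + x4 ≤ 2 := by
      by_contra! hcon
      nlinarith
    have h05 : (x0 + x5) * (x0 + 2) ≤ 3 + x0 ^ 2 := by
      nlinarith [mul_nonneg (sub_nonneg.2 h2.le) (show 0 ≤ x0 + x5 by linarith)]
    have : x0 + x5 + x3 ≤ 3 := by
      have e : 0 < (x0 + 1) * (x0 + 2) := by positivity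
      refine le_of_mul_le_mul_right ?_ e
      have e1 := mul_le_mul_of_nonneg_right h05 hq.le
      have e2 := mul_le_mul_of_nonneg_right hx3 (show 0 ≤ x0 + 2 by linarith)
      have e3 : (3 + x0 ^ 2) * (x0 + 1) + 2 * (x0 + 2) ≤ 3 * ((x0 + 1) * (x0 + 2)) := by
        linarith [mul_nonneg (mul_nonneg (sub_nonneg.2 h0) (sub_nonneg.2 hp.le)) hq.le,
          mul_nonneg (sub_nonneg.2 h0) (sub_nonneg.2 hp.le)]
      linarith
    linarith

lemma sum_latin_excess {G : Type*} [AddCommGroup G] [Fintype G] (x y z : G → ℝ) :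
    ∑ i, ∑ j, excess (x i) (y j) (z (-(i + j))) =
      (∑ i, x i) * (∑ i, y i) + (∑ i, y i) * (∑ i, z i) + (∑ i, z i) * (∑ i, x i) -
        Fintype.card G * (∑ i, x i + ∑ i, y i + ∑ i, z i) / 2 := by
  have hz : ∀ i, ∑ j, z (-(i + j)) = ∑ j, z j := fun i =>
    Fintype.sum_equiv ((Equiv.addLeft i).trans (Equiv.neg G)) _ _ fun _ => rfl
  have hz' : ∀ j, ∑ i, z (-(i + j)) = ∑ i, z i := fun j =>
    Fintype.sum_equiv ((Equiv.addRight j).trans (Equiv.neg G)) _ _ fun _ => rfl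
  have hyz : ∑ i, ∑ j, y j * z (-(i + j)) = (∑ i, y i) * ∑ i, z i := by
    rw [Finset.sum_comm, Finset.sum_mul]
    simp_rw [← Finset.mul_sum, hz']
  simp only [excess, Finset.sum_sub_distrib, Finset.sum_add_distrib, ← Finset.sum_div, hyz, hz,
    Finset.sum_const, Finset.card_univ, nsmul_eq_mul, ← Finset.mul_sum, ← Finset.sum_mul]
  ring

lemma sum_latin_excess_le {M : ℕ} [NeZero M] (x y z : ℕ → ℝ)
    (h : ∀ i j k, i < M → j < M → k < M → M ≤ i + j + k → excess (x i) (y j) (z k) ≤ 0) :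
    (∑ i ∈ Finset.range M, x i) * (∑ i ∈ Finset.range M, y i) +
      (∑ i ∈ Finset.range M, y i) * (∑ i ∈ Finset.range M, z i) +
      (∑ i ∈ Finset.range M, z i) * (∑ i ∈ Finset.range M, x i) -
      M * (∑ i ∈ Finset.range M, x i + ∑ i ∈ Finset.range M, y i + ∑ i ∈ Finset.range M, z i) / 2
      ≤ excess (x 0) (y 0) (z 0) := by
  have hsum : ∀ w : ℕ → ℝ, ∑ i ∈ Finset.range M, w i = ∑ i : ZMod M, w i.val := by
    intro w
    refine Finset.sum_bij' (fun i _ => (i : ZMod M)) (fun i _ => i.val) ?_ ?_ ?_ ?_ ?_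
    · simp
    · simp [ZMod.val_lt]
    · intro i hi
      exact ZMod.val_cast_of_lt (Finset.mem_range.1 hi)
    · simp
    · intro i hi
      rw [ZMod.val_cast_of_lt (Finset.mem_range.1 hi)]
  have key := sum_latin_excess (fun i : ZMod M => x i.val) (fun i => y i.val) (fun i => z i.val)
  rw [ZMod.card] at key
  simp only [hsum]
  rw [← key, ← Fintype.sum_prod_type']
  rw [← Finset.add_sum_erase _ _ (Finset.mem_univ ((0, 0) : ZMod M × ZMod M))]
  simp only [add_zero, neg_zero, ZMod.val_zero, add_le_iff_nonpos_right]
  refine Finset.sum_nonpos fun ij hij => ?_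
  obtain ⟨i, j⟩ := ij
  refine h _ _ _ (ZMod.val_lt _) (ZMod.val_lt _) (ZMod.val_lt _) ?_
  refine Nat.le_of_dvd ?_ ?_
  · dsimp only
    by_contra hcon
    have h1 : i.val = 0 := by omega
    have h2 : j.val = 0 := by omega
    rw [ZMod.val_eq_zero] at h1 h2
    simp [h1, h2] at hij
  · rw [← ZMod.natCast_eq_zero_iff]
    simp

lemma le_sum_tail_and_sum_tail_le {a : ℕ → ℝ} (ha : Antitone a) (ha0 : ∀ i, 0 ≤ a i) {M : ℕ}
    (hM : 0 < M) : a M ≤ ∑ i ∈ Finset.range M, a (M + i) ∧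
      ∑ i ∈ Finset.range M, a (M + i) ≤ M * a M := by
  constructor
  · exact Finset.single_le_sum (f := fun i => a (M + i)) (fun i _ => ha0 _) (Finset.mem_range.2 hM)
  · calc _ ≤ ∑ i ∈ Finset.range M, a M := Finset.sum_le_sum fun i _ => ha (by omega)
      _ = _ := by simp

lemma eq_zero_or_pos_of_antitone {a : ℕ → ℝ} (ha : Antitone a) (ha0 : ∀ i, 0 ≤ a i) :
    (a 1 = 0 ∧ a 2 = 0 ∧ a 3 = 0) ∨ (0 < a 1 ∧ a 2 = 0 ∧ a 3 = 0) ∨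
      (0 < a 1 ∧ 0 < a 2 ∧ a 3 = 0) ∨ (0 < a 1 ∧ 0 < a 2 ∧ 0 < a 3) := by
  have h12 : a 2 ≤ a 1 := ha (by norm_num)
  have h23 : a 3 ≤ a 2 := ha (by norm_num)
  have := ha0 3
  rcases (ha0 3).eq_or_lt with h3 | h3
  · rcases (ha0 2).eq_or_lt with h2 | h2
    · rcases (ha0 1).eq_or_lt with h1 | h1
      · exact Or.inl ⟨h1.symm, h2.symm, h3.symm⟩
      · exact Or.inr (Or.inl ⟨h1, h2.symm, h3.symm⟩)
    · exact Or.inr (Or.inr (Or.inl ⟨by linarith, h2, h3.symm⟩))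
  · exact Or.inr (Or.inr (Or.inr ⟨by linarith, by linarith, h3⟩))

/-- Bounds on a sum `a` of four values and the total `t` of the other two sums that keep the excess
of the averages nonpositive. -/
def SmallSum (a t : ℝ) : Prop := (a ≤ 3 / 4 ∧ t ≤ 6) ∨ (a ≤ 1 / 4 ∧ t ≤ 13 / 2)

lemma SmallSum.le {a b c : ℝ} (ha : 0 ≤ a) (hb : 0 ≤ b) (hc : 0 ≤ c) (h : SmallSum a (b + c)) :
    a * b + b * c + c * a ≤ 2 * (a + b + c) := by
  have h1 : b * c ≤ (b + c) ^ 2 / 4 := by nlinarith [sq_nonneg (b - c)]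
  have h2 : a * (b + c) + (b + c) ^ 2 / 4 ≤ 2 * (a + (b + c)) := by
    have ht : 0 ≤ b + c := by linarith
    generalize b + c = t at *
    rcases h with ⟨h3, h4⟩ | ⟨h3, h4⟩
    · nlinarith [mul_nonneg (sub_nonneg.2 h3) ht, mul_nonneg (sub_nonneg.2 h4) ht]
    · nlinarith [mul_nonneg (sub_nonneg.2 h3) ht, mul_nonneg (sub_nonneg.2 h4) ht]
  linarith

set_option maxHeartbeats 4000000 in
lemma four_sums {a b c : ℕ → ℝ} (ha : Antitone a) (hb : Antitone b) (hc : Antitone c)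
    (ha0 : ∀ i, 0 ≤ a i) (hb0 : ∀ i, 0 ≤ b i) (hc0 : ∀ i, 0 ≤ c i)
    (ha1 : a 0 ≤ 1) (hb1 : b 0 ≤ 1) (hc1 : c 0 ≤ 1)
    (h : ∀ i j k, i < 4 → j < 4 → k < 4 → 4 ≤ i + j + k →
      0 < a i → 0 < b j → 0 < c k → a i + b j + c k ≤ 3 / 2)
    (ha' : 0 < a 0) (hb' : 0 < b 0) (hc' : 0 < c 0) :
    a 0 + a 1 + a 2 + a 3 + (b 0 + b 1 + b 2 + b 3) + (c 0 + c 1 + c 2 + c 3) ≤ 6 ∨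
    SmallSum (a 0 + a 1 + a 2 + a 3) ((b 0 + b 1 + b 2 + b 3) + (c 0 + c 1 + c 2 + c 3)) ∨
    SmallSum (b 0 + b 1 + b 2 + b 3) ((c 0 + c 1 + c 2 + c 3) + (a 0 + a 1 + a 2 + a 3)) ∨
    SmallSum (c 0 + c 1 + c 2 + c 3) ((a 0 + a 1 + a 2 + a 3) + (b 0 + b 1 + b 2 + b 3)) := by
  have key : ∀ i j k, (i < 4 ∧ j < 4 ∧ k < 4 ∧ 4 ≤ i + j + k) → (0 < a i ∧ 0 < b j ∧ 0 < c k) →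
      a i + b j + c k ≤ 3 / 2 := fun i j k h1 h2 =>
      h i j k h1.1 h1.2.1 h1.2.2.1 h1.2.2.2 h2.1 h2.2.1 h2.2.2
  have h013 := key 0 1 3 (by norm_num)
  have h031 := key 0 3 1 (by norm_num)
  have h103 := key 1 0 3 (by norm_num)
  have h130 := key 1 3 0 (by norm_num)
  have h301 := key 3 0 1 (by norm_num)
  have h310 := key 3 1 0 (by norm_num)
  have h022 := key 0 2 2 (by norm_num)
  have h202 := key 2 0 2 (by norm_num)
  have h220 := key 2 2 0 (by norm_num)
  have h112 := key 1 1 2 (by norm_num)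
  have h121 := key 1 2 1 (by norm_num)
  have h211 := key 2 1 1 (by norm_num)
  have h023 := key 0 2 3 (by norm_num)
  have h032 := key 0 3 2 (by norm_num)
  have h203 := key 2 0 3 (by norm_num)
  have h230 := key 2 3 0 (by norm_num)
  have h302 := key 3 0 2 (by norm_num)
  have h320 := key 3 2 0 (by norm_num)
  have h122 := key 1 2 2 (by norm_num)
  have h212 := key 2 1 2 (by norm_num)
  have h221 := key 2 2 1 (by norm_num)
  have a01 : a 1 ≤ a 0 := ha (by norm_num)
  have a12 : a 2 ≤ a 1 := ha (by norm_num)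
  have a23 : a 3 ≤ a 2 := ha (by norm_num)
  have b01 : b 1 ≤ b 0 := hb (by norm_num)
  have b12 : b 2 ≤ b 1 := hb (by norm_num)
  have b23 : b 3 ≤ b 2 := hb (by norm_num)
  have c01 : c 1 ≤ c 0 := hc (by norm_num)
  have c12 : c 2 ≤ c 1 := hc (by norm_num)
  have c23 : c 3 ≤ c 2 := hc (by norm_num)
  rcases le_or_gt (a 0 + a 1 + a 2 + a 3 + (b 0 + b 1 + b 2 + b 3) + (c 0 + c 1 + c 2 + c 3)) 6
    with hσ | hσ
  · exact Or.inl hσ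
  right
  unfold SmallSum
  have sa := eq_zero_or_pos_of_antitone ha ha0
  have sb := eq_zero_or_pos_of_antitone hb hb0
  have sc := eq_zero_or_pos_of_antitone hc hc0
  clear key h ha hb hc ha0 hb0 hc0
  rcases sa with ⟨a1, a2, a3⟩ | ⟨a1, a2, a3⟩ | ⟨a1, a2, a3⟩ | ⟨a1, a2, a3⟩ <;>
  rcases sb with ⟨b1, b2, b3⟩ | ⟨b1, b2, b3⟩ | ⟨b1, b2, b3⟩ | ⟨b1, b2, b3⟩ <;>
  rcases sc with ⟨c1, c2, c3⟩ | ⟨c1, c2, c3⟩ | ⟨c1, c2, c3⟩ | ⟨c1, c2, c3⟩ <;>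
  simp only [ha', hb', hc', a1, a2, a3, b1, b2, b3, c1, c2, c3, lt_irrefl, and_true,
    and_false, false_imp_iff, forall_const, and_self] at * <;>
  first
  | (exfalso; linarith)
  | exact Or.inl (Or.inl ⟨by linarith, by linarith⟩)
  | exact Or.inl (Or.inr ⟨by linarith, by linarith⟩)
  | exact Or.inr (Or.inl (Or.inl ⟨by linarith, by linarith⟩))
  | exact Or.inr (Or.inl (Or.inr ⟨by linarith, by linarith⟩))
  | exact Or.inr (Or.inr (Or.inl ⟨by linarith, by linarith⟩))
  | exact Or.inr (Or.inr (Or.inr ⟨by linarith, by linarith⟩))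

/-- The condition on the three values of `f` in the conclusion of the main theorem. -/
def LargePositive (a b c : ℝ) : Prop := 0 < a ∧ 0 < b ∧ 0 < c ∧ 3 / 2 < a + b + c

lemma excess_pos_mono {a b c a' b' c' : ℝ} (ha : 0 ≤ a) (hb : 0 ≤ b) (hc : 0 ≤ c)
    (ha1 : a ≤ 1) (hb1 : b ≤ 1) (hc1 : c ≤ 1) (haa : a ≤ a') (hbb : b ≤ b') (hcc : c ≤ c')
    (h : 0 < excess a b c) : 0 < excess a' b' c' := by
  have pair : ∀ x y z : ℝ, 0 ≤ x → 0 ≤ y → y ≤ 1 → 0 ≤ z → z ≤ 1 → 0 < excess x y z →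
      0 < y + z - 1 / 2 := by
    intro x y z hx hy hy1 hz hz1 h
    unfold excess at h
    by_contra! hcon
    nlinarith [mul_nonneg hy (sub_nonneg.2 hz1), mul_nonneg hz (sub_nonneg.2 hy1),
      mul_nonneg hx (sub_nonneg.2 hcon)]
  have p1 := pair a b c ha hb hb1 hc hc1 h
  have p2 := pair b c a hb hc hc1 ha ha1 (by unfold excess at *; linarith)
  have p3 := pair c a b hc ha ha1 hb hb1 (by unfold excess at *; linarith)
  have h1 : 0 < excess a' b c := by
    unfold excess at *; nlinarith
  have h2 : 0 < excess a' b' c := by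
    unfold excess at *; nlinarith
  unfold excess at *; nlinarith

lemma LargePositive.of_excess_pos {a b c : ℝ} (ha : a ∈ Set.Icc (0 : ℝ) 1)
    (hb : b ∈ Set.Icc (0 : ℝ) 1) (hc : c ∈ Set.Icc (0 : ℝ) 1) (h : 0 < excess a b c) :
    LargePositive a b c := by
  obtain ⟨ha0, ha1⟩ := ha
  obtain ⟨hb0, hb1⟩ := hb
  obtain ⟨hc0, hc1⟩ := hc
  have pos : ∀ x y z : ℝ, 0 ≤ x → 0 ≤ y → 0 ≤ z → y ≤ 1 → z ≤ 1 → 0 < excess x y z → 0 < x := by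
    intro x y z hx hy hz hy1 hz1 h
    refine hx.lt_of_ne' fun h0 => ?_
    subst h0
    unfold excess at h
    nlinarith [mul_nonneg hy (sub_nonneg.2 hz1), mul_nonneg hz (sub_nonneg.2 hy1)]
  refine ⟨pos a b c ha0 hb0 hc0 hb1 hc1 h,
    pos b c a hb0 hc0 ha0 hc1 ha1 (by unfold excess at *; linarith),
    pos c a b hc0 ha0 hb0 ha1 hb1 (by unfold excess at *; linarith), ?_⟩
  unfold excess at h
  by_contra! hcon
  nlinarith [sq_nonneg (a - b), sq_nonneg (b - c), sq_nonneg (a - c)]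

lemma exists_antitone_profile (p : ℕ) [Fact p.Prime] (f : (ZMod p)ˣ → ℝ)
    (hf : ∀ u, f u ∈ Set.Icc (0 : ℝ) 1) :
    ∃ a : ℕ → ℝ, Antitone a ∧ (∀ i, a i ∈ Set.Icc (0 : ℝ) 1) ∧
      ∑ i ∈ Finset.range (p - 1), a i = ∑ u, f u ∧
      ∀ i < p - 1, ∃ s : Finset (ZMod p), s.card = i + 1 ∧
        ∀ z ∈ s, ∃ u : (ZMod p)ˣ, (u : ZMod p) = z ∧ a i ≤ f u := by
  have hcard : Fintype.card (ZMod p)ˣ = p - 1 := by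
    rw [ZMod.card_units_eq_totient, Nat.totient_prime Fact.out]
  let e : Fin (p - 1) ≃ (ZMod p)ˣ := (Fintype.equivFinOfCardEq hcard).symm
  let σ := Tuple.sort fun i => - f (e i)
  have hσ : Monotone ((fun i => - f (e i)) ∘ σ) := Tuple.monotone_sort _
  have hσ' : ∀ i j, i ≤ j → f (e (σ j)) ≤ f (e (σ i)) := fun i j hij => by
    simpa using hσ hij
  refine ⟨fun i => if h : i < p - 1 then f (e (σ ⟨i, h⟩)) else 0, ?_, ?_, ?_, ?_⟩
  · intro i j hij
    dsimp only
    split_ifs with h1 h2 h2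
    · exact hσ' _ _ hij
    · omega
    · exact (hf _).1
    · exact le_rfl
  · intro i
    dsimp only
    split_ifs
    · exact hf _
    · simp
  · rw [Finset.sum_range]
    simp only [Fin.is_lt, dite_true, Fin.eta]
    exact Fintype.sum_equiv (σ.trans e) _ _ fun _ => rfl
  · intro i hi
    refine ⟨(Finset.Iic (⟨i, hi⟩ : Fin (p - 1))).image fun j => (e (σ j) : ZMod p), ?_, ?_⟩
    · rw [Finset.card_image_of_injective, Fin.card_Iic]
      exact Units.val_injective.comp (e.injective.comp σ.injective)
    · intro z hz
      obtain ⟨j, hj, rfl⟩ := Finset.mem_image.1 hz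
      refine ⟨_, rfl, ?_⟩
      dsimp only
      rw [dif_pos hi]
      exact hσ' _ _ (Finset.mem_Iic.1 hj)

open scoped Pointwise in
lemma exists_add_add_eq_of_card {p : ℕ} [Fact p.Prime] {s t r : Finset (ZMod p)}
    (hs : s.Nonempty) (ht : t.Nonempty) (hr : r.Nonempty)
    (h : p + 2 ≤ s.card + t.card + r.card) (x : ZMod p) :
    ∃ a ∈ s, ∃ b ∈ t, ∃ c ∈ r, x = a + b + c := by
  have h1 := ZMod.cauchy_davenport (p := p) Fact.out hs ht
  have h2 := ZMod.cauchy_davenport (p := p) Fact.out (hs.add ht) hr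
  have hr1 := hr.card_pos
  have hu : s + t + r = Finset.univ := by
    rw [← Finset.card_eq_iff_eq_univ, ZMod.card]
    refine le_antisymm ?_ ?_
    · simpa [ZMod.card] using Finset.card_le_univ (s + t + r)
    · omega
  have hx : x ∈ s + t + r := hu ▸ Finset.mem_univ x
  obtain ⟨y, hy, c, hc, rfl⟩ := Finset.mem_add.1 hx
  obtain ⟨a, ha, b, hb, rfl⟩ := Finset.mem_add.1 hy
  exact ⟨a, ha, b, hb, c, hc, rfl⟩

/-- Every element of `R` is a sum of three units at which `f`, `g`, `h` take values satisfying
`C`. -/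
def AttainsEverywhere {R : Type*} [CommRing R] (C : ℝ → ℝ → ℝ → Prop) (f g h : Rˣ → ℝ) : Prop :=
  ∀ x : R, ∃ u v w : Rˣ, x = u + v + w ∧ C (f u) (g v) (h w)

/-- The mean of `f` over the units of `R`. -/
noncomputable def unitAverage {R : Type*} [CommRing R] [Fintype Rˣ] (f : Rˣ → ℝ) : ℝ :=
  (∑ u, f u) / Fintype.card Rˣ

lemma unitAverage_mem {R : Type*} [CommRing R] [Fintype Rˣ] {f : Rˣ → ℝ}
    (hf : ∀ u, f u ∈ Set.Icc (0 : ℝ) 1) : unitAverage f ∈ Set.Icc (0 : ℝ) 1 := by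
  constructor
  · exact div_nonneg (Finset.sum_nonneg fun u _ => (hf u).1) (Nat.cast_nonneg _)
  · refine div_le_one_of_le₀ ?_ (Nat.cast_nonneg _)
    calc _ ≤ ∑ _u : Rˣ, (1 : ℝ) := Finset.sum_le_sum fun u _ => (hf u).2
      _ = _ := by simp

/-- Any `f`, `g`, `h` with values in `[0, 1]` whose averages have positive excess represent every
element of `R` with values satisfying `C`. -/
def ExcessForces (C : ℝ → ℝ → ℝ → Prop) (R : Type*) [CommRing R] [Fintype Rˣ] : Prop :=
  ∀ f g h : Rˣ → ℝ, (∀ u, f u ∈ Set.Icc (0 : ℝ) 1) → (∀ u, g u ∈ Set.Icc (0 : ℝ) 1) →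
    (∀ u, h u ∈ Set.Icc (0 : ℝ) 1) →
    0 < excess (unitAverage f) (unitAverage g) (unitAverage h) → AttainsEverywhere C f g h

/-- Any `f` with values in `[0, 1]` and average above `1 / 2` represents every element of `R` with
values satisfying `C`. -/
def DensityForces (C : ℝ → ℝ → ℝ → Prop) (R : Type*) [CommRing R] [Fintype Rˣ] : Prop :=
  ∀ f : Rˣ → ℝ, (∀ u, f u ∈ Set.Icc (0 : ℝ) 1) → 1 / 2 < unitAverage f →
    AttainsEverywhere C f f f

section Product
variable {R S : Type*} [CommRing R] [CommRing S] [Fintype Rˣ] [Fintype Sˣ] [Fintype (R × S)ˣ]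

/-- The average of `f` over the second coordinate. -/
noncomputable def fiberAverage (f : (R × S)ˣ → ℝ) (u : Rˣ) : ℝ :=
  unitAverage fun v : Sˣ => f (MulEquiv.prodUnits.symm (u, v))

lemma unitAverage_fiberAverage (f : (R × S)ˣ → ℝ) :
    unitAverage (fiberAverage f) = unitAverage f := by
  have hc : Fintype.card (R × S)ˣ = Fintype.card Rˣ * Fintype.card Sˣ := by
    rw [← Fintype.card_prod]
    exact Fintype.card_congr MulEquiv.prodUnits.toEquiv
  have hs : ∑ u, f u = ∑ u : Rˣ, ∑ v : Sˣ, f (MulEquiv.prodUnits.symm (u, v)) := by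
    rw [← Fintype.sum_prod_type']
    exact (Fintype.sum_equiv MulEquiv.prodUnits.symm.toEquiv _ _ fun _ => rfl).symm
  simp only [unitAverage, fiberAverage, hc, hs, ← Finset.sum_div, div_div, Nat.cast_mul]
  rw [mul_comm (Fintype.card Rˣ : ℝ)]

omit [Fintype Rˣ] [Fintype (R × S)ˣ] in
lemma AttainsEverywhere.prod {C : ℝ → ℝ → ℝ → Prop} {f g h : (R × S)ˣ → ℝ}
    (hf : ∀ u, f u ∈ Set.Icc (0 : ℝ) 1) (hg : ∀ u, g u ∈ Set.Icc (0 : ℝ) 1)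
    (hh : ∀ u, h u ∈ Set.Icc (0 : ℝ) 1)
    (hR : AttainsEverywhere (fun a b c => 0 < excess a b c)
      (fiberAverage f) (fiberAverage g) (fiberAverage h))
    (hS : ExcessForces C S) : AttainsEverywhere C f g h := by
  rintro ⟨x, y⟩
  obtain ⟨u, v, w, hx, he⟩ := hR x
  obtain ⟨u', v', w', hy, hC⟩ := hS _ _ _ (fun _ => hf _) (fun _ => hg _) (fun _ => hh _) he y
  exact ⟨_, _, _, by rw [hx, hy]; rfl, hC⟩

lemma ExcessForces.prod {C : ℝ → ℝ → ℝ → Prop}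
    (hR : ExcessForces (fun a b c => 0 < excess a b c) R) (hS : ExcessForces C S) :
    ExcessForces C (R × S) := by
  intro f g h hf hg hh he
  refine AttainsEverywhere.prod hf hg hh (hR _ _ _ ?_ ?_ ?_ ?_) hS
  · exact fun _ => unitAverage_mem fun _ => hf _
  · exact fun _ => unitAverage_mem fun _ => hg _
  · exact fun _ => unitAverage_mem fun _ => hh _
  · simpa only [unitAverage_fiberAverage] using he

lemma DensityForces.prod {C : ℝ → ℝ → ℝ → Prop}
    (hR : DensityForces (fun a b c => 0 < excess a b c) R) (hS : ExcessForces C S) :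
    DensityForces C (R × S) := by
  intro f hf he
  refine AttainsEverywhere.prod hf hf hf (hR _ ?_ ?_) hS
  · exact fun _ => unitAverage_mem fun _ => hf _
  · simpa only [unitAverage_fiberAverage] using he

end Product

section Congr
variable {R S : Type*} [CommRing R] [CommRing S] [Fintype Rˣ] [Fintype Sˣ]

lemma unitAverage_comp_mapEquiv (e : R ≃+* S) (f : Sˣ → ℝ) :
    unitAverage (fun u => f (Units.mapEquiv (e : R ≃* S) u)) = unitAverage f := by
  unfold unitAverage
  rw [Fintype.card_congr (Units.mapEquiv (e : R ≃* S)).toEquiv]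
  congr 1
  exact Fintype.sum_equiv (Units.mapEquiv (e : R ≃* S)).toEquiv _ _ fun _ => rfl

omit [Fintype Rˣ] [Fintype Sˣ] in
lemma AttainsEverywhere.of_comp_mapEquiv {C : ℝ → ℝ → ℝ → Prop} (e : R ≃+* S) {f g h : Sˣ → ℝ}
    (H : AttainsEverywhere C (fun u => f (Units.mapEquiv (e : R ≃* S) u))
      (fun u => g (Units.mapEquiv (e : R ≃* S) u)) (fun u => h (Units.mapEquiv (e : R ≃* S) u))) :
    AttainsEverywhere C f g h := by
  intro x
  obtain ⟨u, v, w, hx, hC⟩ := H (e.symm x)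
  refine ⟨_, _, _, ?_, hC⟩
  rw [RingEquiv.symm_apply_eq] at hx
  simp [hx]

lemma ExcessForces.congr {C : ℝ → ℝ → ℝ → Prop} (e : R ≃+* S) (hR : ExcessForces C R) :
    ExcessForces C S := by
  intro f g h hf hg hh he
  refine AttainsEverywhere.of_comp_mapEquiv e
    (hR _ _ _ (fun _ => hf _) (fun _ => hg _) (fun _ => hh _) ?_)
  simpa only [unitAverage_comp_mapEquiv] using he

lemma DensityForces.congr {C : ℝ → ℝ → ℝ → Prop} (e : R ≃+* S) (hR : DensityForces C R) :
    DensityForces C S := by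
  intro f hf he
  refine AttainsEverywhere.of_comp_mapEquiv e (hR _ (fun _ => hf _) ?_)
  simpa only [unitAverage_comp_mapEquiv] using he

end Congr

lemma excess_average_nonpos {M : ℕ} (hM : 5 ≤ M) {a b c : ℕ → ℝ}
    (ha : Antitone a) (hb : Antitone b) (hc : Antitone c)
    (ha' : ∀ i, a i ∈ Set.Icc (0 : ℝ) 1) (hb' : ∀ i, b i ∈ Set.Icc (0 : ℝ) 1)
    (hc' : ∀ i, c i ∈ Set.Icc (0 : ℝ) 1)
    (h : ∀ i j k, i < 2 * M → j < 2 * M → k < 2 * M → 2 * M ≤ i + j + k →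
      excess (a i) (b j) (c k) ≤ 0) :
    excess ((∑ i ∈ Finset.range (2 * M), a i) / (2 * M : ℕ))
      ((∑ i ∈ Finset.range (2 * M), b i) / (2 * M : ℕ))
      ((∑ i ∈ Finset.range (2 * M), c i) / (2 * M : ℕ)) ≤ 0 := by
  have : NeZero M := ⟨by omega⟩
  have l1 := sum_latin_excess_le a b (fun k => c (M + k)) (M := M)
    fun i j k hi hj hk hs => h _ _ _ (by omega) (by omega) (by omega) (by omega)
  have l2 := sum_latin_excess_le a (fun k => b (M + k)) c (M := M)
    fun i j k hi hj hk hs => h _ _ _ (by omega) (by omega) (by omega) (by omega)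
  have l3 := sum_latin_excess_le (fun k => a (M + k)) b c (M := M)
    fun i j k hi hj hk hs => h _ _ _ (by omega) (by omega) (by omega) (by omega)
  have h0 := h M M M (by omega) (by omega) (by omega) (by omega)
  have h1 := h 0 M M (by omega) (by omega) (by omega) (by omega)
  have h2 := h M 0 M (by omega) (by omega) (by omega) (by omega)
  have h3 := h M M 0 (by omega) (by omega) (by omega) (by omega)
  obtain ⟨sa, sa'⟩ := le_sum_tail_and_sum_tail_le ha (fun i => (ha' i).1) (M := M) (by omega)
  obtain ⟨sb, sb'⟩ := le_sum_tail_and_sum_tail_le hb (fun i => (hb' i).1) (M := M) (by omega)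
  obtain ⟨sc, sc'⟩ := le_sum_tail_and_sum_tail_le hc (fun i => (hc' i).1) (M := M) (by omega)
  have hM' : (5 : ℝ) ≤ M := by exact_mod_cast hM
  have a0 := ha' 0
  have b0 := hb' 0
  have c0 := hc' 0
  have aM := ha' M
  have bM := hb' M
  have cM := hc' M
  have aM0 : a M ≤ a 0 := ha (Nat.zero_le _)
  have bM0 : b M ≤ b 0 := hb (Nat.zero_le _)
  have cM0 : c M ≤ c 0 := hc (Nat.zero_le _)
  simp only [two_mul, Finset.sum_range_add, Nat.cast_add, add_zero] at *
  generalize ∑ i ∈ Finset.range M, a i = A₀ at *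
  generalize ∑ i ∈ Finset.range M, b i = B₀ at *
  generalize ∑ i ∈ Finset.range M, c i = C₀ at *
  generalize ∑ i ∈ Finset.range M, a (M + i) = A at *
  generalize ∑ i ∈ Finset.range M, b (M + i) = B at *
  generalize ∑ i ∈ Finset.range M, c (M + i) = C at *
  have hn : (0 : ℝ) < M + M := by linarith
  have hform : excess ((A₀ + A) / (M + M)) ((B₀ + B) / (M + M)) ((C₀ + C) / (M + M)) =
      ((A₀ + A) * (B₀ + B) + (B₀ + B) * (C₀ + C) + (C₀ + C) * (A₀ + A) -
        M * (A₀ + A + (B₀ + B) + (C₀ + C))) / (M + M) ^ 2 := by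
    unfold excess
    field_simp
    ring
  rw [hform]
  refine div_nonpos_of_nonpos_of_nonneg ?_ (by positivity)
  unfold excess at *
  have key := heads_le_tail_sums (M := M) (P := 4 * a 0) (R := 4 * b 0) (S := 4 * c 0)
    (α := 4 * a M) (β := 4 * b M) (γ := 4 * c M) (A := 4 * A) (B := 4 * B) (C := 4 * C) hM'
    (by linarith [aM.1]) (by linarith [bM.1]) (by linarith [cM.1])
    (by linarith) (by linarith) (by linarith)
    (by linarith [a0.2]) (by linarith [b0.2]) (by linarith [c0.2])
    (by linarith) (by linarith) (by linarith) (by linarith)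
    (by linarith) (by linarith) (by linarith) (by linarith) (by linarith) (by linarith)
  linarith

lemma average_le_half_of_six {a : ℕ → ℝ} (ha : Antitone a)
    (ha' : ∀ i, a i ∈ Set.Icc (0 : ℝ) 1)
    (h : ∀ i j k, i < 6 → j < 6 → k < 6 → 6 ≤ i + j + k → excess (a i) (a j) (a k) ≤ 0) :
    (∑ i ∈ Finset.range 6, a i) / (6 : ℕ) ≤ 1 / 2 := by
  have mono : ∀ i, 4 * a (i + 1) - 1 ≤ 4 * a i - 1 := fun i => by
    linarith [ha (Nat.le_succ i)]
  have form : ∀ i j k, i < 6 ∧ j < 6 ∧ k < 6 ∧ 6 ≤ i + j + k →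
      (4 * a i - 1) * (4 * a j - 1) + (4 * a j - 1) * (4 * a k - 1) +
        (4 * a k - 1) * (4 * a i - 1) ≤ 3 := fun i j k hs => by
    have := h i j k hs.1 hs.2.1 hs.2.2.1 hs.2.2.2
    unfold excess at this
    linarith
  have key := sum_six_le (by linarith [(ha' 5).1]) (mono 4) (mono 3) (mono 2) (mono 1) (mono 0)
    (by linarith [(ha' 0).2]) (form 0 1 5 (by norm_num)) (form 0 2 4 (by norm_num))
    (form 0 3 3 (by norm_num)) (form 1 1 4 (by norm_num)) (form 2 2 2 (by norm_num))
  simp only [Finset.sum_range_succ, Finset.sum_range_zero]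
  norm_num at key ⊢
  linarith

lemma excess_average_four_nonpos {a b c : ℕ → ℝ}
    (ha : Antitone a) (hb : Antitone b) (hc : Antitone c)
    (ha' : ∀ i, a i ∈ Set.Icc (0 : ℝ) 1) (hb' : ∀ i, b i ∈ Set.Icc (0 : ℝ) 1)
    (hc' : ∀ i, c i ∈ Set.Icc (0 : ℝ) 1)
    (h : ∀ i j k, i < 4 → j < 4 → k < 4 → 4 ≤ i + j + k → ¬ LargePositive (a i) (b j) (c k)) :
    excess ((∑ i ∈ Finset.range 4, a i) / (4 : ℕ)) ((∑ i ∈ Finset.range 4, b i) / (4 : ℕ))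
      ((∑ i ∈ Finset.range 4, c i) / (4 : ℕ)) ≤ 0 := by
  by_contra! hcon
  have mem : ∀ w : ℕ → ℝ, Antitone w → (∀ i, w i ∈ Set.Icc (0 : ℝ) 1) →
      (∑ i ∈ Finset.range 4, w i) / (4 : ℕ) ∈ Set.Icc 0 (w 0) := by
    intro w hw hw'
    constructor
    · exact div_nonneg (Finset.sum_nonneg fun i _ => (hw' i).1) (Nat.cast_nonneg _)
    · rw [div_le_iff₀ (by norm_num)]
      calc _ ≤ ∑ _i ∈ Finset.range 4, w 0 := Finset.sum_le_sum fun i _ => hw (Nat.zero_le i)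
        _ = _ := by simp [mul_comm]
  have ma := mem a ha ha'
  have mb := mem b hb hb'
  have mc := mem c hc hc'
  obtain ⟨pa, pb, pc, -⟩ := LargePositive.of_excess_pos
    ⟨ma.1, ma.2.trans (ha' 0).2⟩ ⟨mb.1, mb.2.trans (hb' 0).2⟩ ⟨mc.1, mc.2.trans (hc' 0).2⟩ hcon
  have key := four_sums ha hb hc (fun i => (ha' i).1) (fun i => (hb' i).1) (fun i => (hc' i).1)
    (ha' 0).2 (hb' 0).2 (hc' 0).2
    (fun i j k hi hj hk hs h1 h2 h3 => not_lt.1 fun h4 => h i j k hi hj hk hs ⟨h1, h2, h3, h4⟩)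
    (pa.trans_le ma.2) (pb.trans_le mb.2) (pc.trans_le mc.2)
  simp only [Finset.sum_range_succ, Finset.sum_range_zero, zero_add, Nat.cast_ofNat] at *
  generalize a 0 + a 1 + a 2 + a 3 = A at *
  generalize b 0 + b 1 + b 2 + b 3 = B at *
  generalize c 0 + c 1 + c 2 + c 3 = C at *
  have le : A * B + B * C + C * A ≤ 2 * (A + B + C) := by
    rcases key with key | key | key | key
    · nlinarith [sq_nonneg (A - B), sq_nonneg (B - C), sq_nonneg (A - C)]
    · exact key.le (by linarith) (by linarith) (by linarith)
    · linarith [key.le (by linarith) (by linarith) (by linarith)]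
    · linarith [key.le (by linarith) (by linarith) (by linarith)]
  unfold excess at hcon
  linarith

section Prime
variable {p : ℕ} [Fact p.Prime]

lemma attainsEverywhere_of_profiles {C : ℝ → ℝ → ℝ → Prop} {f g h : (ZMod p)ˣ → ℝ}
    {a b c : ℝ} (hC : ∀ a' b' c', a ≤ a' → b ≤ b' → c ≤ c' → C a' b' c')
    {i j k : ℕ} (hs : p - 1 ≤ i + j + k)
    (hf : ∃ s : Finset (ZMod p), s.card = i + 1 ∧
      ∀ z ∈ s, ∃ u : (ZMod p)ˣ, (u : ZMod p) = z ∧ a ≤ f u)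
    (hg : ∃ s : Finset (ZMod p), s.card = j + 1 ∧
      ∀ z ∈ s, ∃ u : (ZMod p)ˣ, (u : ZMod p) = z ∧ b ≤ g u)
    (hh : ∃ s : Finset (ZMod p), s.card = k + 1 ∧
      ∀ z ∈ s, ∃ u : (ZMod p)ˣ, (u : ZMod p) = z ∧ c ≤ h u) :
    AttainsEverywhere C f g h := by
  intro x
  obtain ⟨s, hs1, hs2⟩ := hf
  obtain ⟨t, ht1, ht2⟩ := hg
  obtain ⟨r, hr1, hr2⟩ := hh
  obtain ⟨y, hy, z, hz, w, hw, rfl⟩ := exists_add_add_eq_of_card (s := s) (t := t) (r := r)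
    (Finset.card_pos.1 (by omega)) (Finset.card_pos.1 (by omega)) (Finset.card_pos.1 (by omega))
    (by omega) x
  obtain ⟨u, rfl, hu⟩ := hs2 y hy
  obtain ⟨v, rfl, hv⟩ := ht2 z hz
  obtain ⟨q, rfl, hq⟩ := hr2 w hw
  exact ⟨u, v, q, rfl, hC _ _ _ hu hv hq⟩

lemma unitAverage_zmod (f : (ZMod p)ˣ → ℝ) : unitAverage f = (∑ u, f u) / (p - 1 : ℕ) := by
  rw [unitAverage, ZMod.card_units_eq_totient, Nat.totient_prime Fact.out]

end Prime

lemma excessForces_excess_of_prime {p : ℕ} [Fact p.Prime] (hp : 11 ≤ p) :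
    ExcessForces (fun a b c => 0 < excess a b c) (ZMod p) := by
  intro f g h hf hg hh he
  obtain ⟨a, ha, ha', has, haS⟩ := exists_antitone_profile p f hf
  obtain ⟨b, hb, hb', hbs, hbS⟩ := exists_antitone_profile p g hg
  obtain ⟨c, hc, hc', hcs, hcS⟩ := exists_antitone_profile p h hh
  obtain ⟨M, hM⟩ : ∃ M, p - 1 = 2 * M := by
    obtain ⟨r, hr⟩ := (Fact.out : p.Prime).odd_of_ne_two (by omega)
    exact ⟨r, by omega⟩
  rw [unitAverage_zmod, unitAverage_zmod, unitAverage_zmod, ← has, ← hbs, ← hcs, hM] at he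
  by_contra hcon
  refine absurd (excess_average_nonpos (by omega) ha hb hc ha' hb' hc' ?_) (not_le.2 he)
  intro i j k hi hj hk hs
  by_contra! hpos
  refine hcon (attainsEverywhere_of_profiles ?_ (hM ▸ hs) (haS i (by omega)) (hbS j (by omega))
    (hcS k (by omega)))
  intro a' b' c' h1 h2 h3
  exact excess_pos_mono (ha' i).1 (hb' j).1 (hc' k).1 (ha' i).2 (hb' j).2 (hc' k).2 h1 h2 h3 hpos

lemma densityForces_excess_seven : DensityForces (fun a b c => 0 < excess a b c) (ZMod 7) := by
  have : Fact (Nat.Prime 7) := ⟨by norm_num⟩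
  intro f hf he
  obtain ⟨a, ha, ha', has, haS⟩ := exists_antitone_profile 7 f hf
  rw [unitAverage_zmod, ← has] at he
  by_contra hcon
  refine absurd (average_le_half_of_six ha ha' ?_) (not_le.2 he)
  intro i j k hi hj hk hs
  by_contra! hpos
  refine hcon (attainsEverywhere_of_profiles ?_ hs (haS i hi) (haS j hj) (haS k hk))
  intro a' b' c' h1 h2 h3
  exact excess_pos_mono (ha' i).1 (ha' j).1 (ha' k).1 (ha' i).2 (ha' j).2 (ha' k).2 h1 h2 h3 hpos

lemma excessForces_largePositive_five : ExcessForces LargePositive (ZMod 5) := by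
  have : Fact (Nat.Prime 5) := ⟨by norm_num⟩
  intro f g h hf hg hh he
  obtain ⟨a, ha, ha', has, haS⟩ := exists_antitone_profile 5 f hf
  obtain ⟨b, hb, hb', hbs, hbS⟩ := exists_antitone_profile 5 g hg
  obtain ⟨c, hc, hc', hcs, hcS⟩ := exists_antitone_profile 5 h hh
  rw [unitAverage_zmod, unitAverage_zmod, unitAverage_zmod, ← has, ← hbs, ← hcs] at he
  by_contra hcon
  refine absurd (excess_average_four_nonpos ha hb hc ha' hb' hc' ?_) (not_le.2 he)
  intro i j k hi hj hk hs hpos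
  refine hcon (attainsEverywhere_of_profiles ?_ hs (haS i hi) (hbS j hj) (hcS k hk))
  intro a' b' c' h1 h2 h3
  obtain ⟨p1, p2, p3, p4⟩ := hpos
  exact ⟨by linarith, by linarith, by linarith, by linarith⟩

lemma unitAverage_of_subsingleton {R : Type*} [CommRing R] [Subsingleton R] [Fintype Rˣ]
    (f : Rˣ → ℝ) : unitAverage f = f 1 := by
  rw [unitAverage, Fintype.sum_subsingleton f 1,
    Fintype.card_eq_one_iff.2 ⟨1, fun u => Subsingleton.elim _ _⟩]
  simp

lemma excessForces_excess_of_subsingleton {R : Type*} [CommRing R] [Subsingleton R]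
    [Fintype Rˣ] : ExcessForces (fun a b c => 0 < excess a b c) R := by
  intro f g h _ _ _ he x
  rw [unitAverage_of_subsingleton, unitAverage_of_subsingleton, unitAverage_of_subsingleton] at he
  exact ⟨1, 1, 1, Subsingleton.elim _ _, he⟩

lemma ExcessForces.densityForces {C : ℝ → ℝ → ℝ → Prop} {R : Type*} [CommRing R] [Fintype Rˣ]
    (hR : ExcessForces C R) : DensityForces C R := by
  intro f hf he
  refine hR f f f hf hf hf ?_
  unfold excess
  nlinarith

lemma ExcessForces.largePositive {R : Type*} [CommRing R] [Fintype Rˣ]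
    (hR : ExcessForces (fun a b c => 0 < excess a b c) R) : ExcessForces LargePositive R := by
  intro f g h hf hg hh he x
  obtain ⟨u, v, w, hx, hC⟩ := hR f g h hf hg hh he x
  exact ⟨u, v, w, hx, .of_excess_pos (hf u) (hg v) (hh w) hC⟩

lemma excessForces_excess_zmod (n : ℕ) [hn0 : NeZero n] (hn : Squarefree n)
    (hp : ∀ p, p.Prime → p ∣ n → 11 ≤ p) :
    ExcessForces (fun a b c => 0 < excess a b c) (ZMod n) := by
  revert hn0
  induction n using induction_on_primes with
  | zero => exact fun {hn0} => absurd rfl hn0.out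
  | one => exact fun {_} => excessForces_excess_of_subsingleton
  | prime_mul p a hpp ih =>
    intro hn0
    have : NeZero a := ⟨right_ne_zero_of_mul (NeZero.ne (p * a))⟩
    have : Fact p.Prime := ⟨hpp⟩
    exact ((excessForces_excess_of_prime (hp p hpp (dvd_mul_right _ _))).prod
      (ih (hn.squarefree_of_dvd (dvd_mul_left _ _)) fun q hq hqa => hp q hq (hqa.mul_left _))).congr
        (ZMod.chineseRemainder (Nat.coprime_of_squarefree_mul hn)).symm

lemma exists_eq_mul_of_prime_of_squarefree {p n : ℕ} (hp : p.Prime) (hn : Squarefree n) :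
    ∃ d k, n = d * k ∧ (d = 1 ∨ d = p) ∧ ¬ p ∣ k := by
  by_cases h : p ∣ n
  · obtain ⟨k, rfl⟩ := h
    refine ⟨p, k, rfl, Or.inr rfl, fun hk => hp.one_lt.ne' ?_⟩
    exact Nat.eq_one_of_dvd_coprimes (Nat.coprime_of_squarefree_mul hn) dvd_rfl hk
  · exact ⟨1, n, (one_mul n).symm, Or.inl rfl, h⟩

lemma densityForces_largePositive_zmod (n : ℕ) [NeZero n] (hn : Squarefree n) (h2 : ¬ 2 ∣ n)
    (h3 : ¬ 3 ∣ n) : DensityForces LargePositive (ZMod n) := by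
  obtain ⟨d, r, rfl, hd, hr⟩ := exists_eq_mul_of_prime_of_squarefree
    (show Nat.Prime 5 by norm_num) hn
  obtain ⟨e, k, rfl, he, hk⟩ := exists_eq_mul_of_prime_of_squarefree
    (show Nat.Prime 7 by norm_num) (hn.squarefree_of_dvd (dvd_mul_left r d))
  have hne := NeZero.ne (d * (e * k))
  have : NeZero d := ⟨left_ne_zero_of_mul hne⟩
  have : NeZero (e * k) := ⟨right_ne_zero_of_mul hne⟩
  have : NeZero e := ⟨left_ne_zero_of_mul (right_ne_zero_of_mul hne)⟩
  have : NeZero k := ⟨right_ne_zero_of_mul (right_ne_zero_of_mul hne)⟩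
  have hd' : ExcessForces LargePositive (ZMod d) := by
    rcases hd with rfl | rfl
    · exact excessForces_excess_of_subsingleton.largePositive
    · convert excessForces_largePositive_five
  have he' : DensityForces (fun a b c => 0 < excess a b c) (ZMod e) := by
    rcases he with rfl | rfl
    · exact excessForces_excess_of_subsingleton.densityForces
    · convert densityForces_excess_seven
  have hek := hn.squarefree_of_dvd (dvd_mul_left (e * k) d)
  have hk' : ExcessForces (fun a b c => 0 < excess a b c) (ZMod k) := by
    refine excessForces_excess_zmod k (hek.squarefree_of_dvd (dvd_mul_left _ _)) ?_
    intro p hp hpk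
    by_contra! hlt
    have hpn : p ∣ d * (e * k) := (hpk.mul_left e).mul_left d
    have hpr : p ∣ e * k := hpk.mul_left e
    interval_cases p <;> contradiction
  have hek' := (he'.prod hk').congr (ZMod.chineseRemainder (Nat.coprime_of_squarefree_mul hek)).symm
  exact (hek'.prod hd').congr
    ((RingEquiv.prodComm).trans (ZMod.chineseRemainder (Nat.coprime_of_squarefree_mul hn)).symm)

theorem stmt_5 (m : ℕ) [NeZero m] (hodd : Odd m) (hsf : Squarefree m)
    (h3 : (3 : ℕ) ∣ m) (f : (ZMod m)ˣ → ℝ)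
    (hmem : ∀ a, f a ∈ Set.Icc (0 : ℝ) 1)
    (hsupp : ∀ a : (ZMod m)ˣ,
      ZMod.castHom h3 (ZMod 3) (a : ZMod m) ≠ 1 → f a = 0)
    (hsum : (Nat.totient m : ℝ) / 4 < ∑ a : (ZMod m)ˣ, f a) :
    ∀ x : ZMod m, ZMod.castHom h3 (ZMod 3) x = 0 →
      ∃ a₁ a₂ a₃ : (ZMod m)ˣ,
        x = (a₁ : ZMod m) + (a₂ : ZMod m) + (a₃ : ZMod m) ∧
        0 < f a₁ ∧ 0 < f a₂ ∧ 0 < f a₃ ∧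
        3 / 2 < f a₁ + f a₂ + f a₃ := by
  intro x hx
  obtain ⟨n, rfl⟩ := h3
  have hco := Nat.coprime_of_squarefree_mul hsf
  have hn0 : n ≠ 0 := right_ne_zero_of_mul (NeZero.ne (3 * n))
  have : NeZero n := ⟨hn0⟩
  have hn2 : ¬ 2 ∣ n := fun h => (Nat.not_even_iff_odd.2 hodd) (even_iff_two_dvd.2 (h.mul_left 3))
  have hn3 : ¬ 3 ∣ n := (Nat.Prime.coprime_iff_not_dvd (by norm_num)).1 hco
  let e := ZMod.chineseRemainder hco
  have hfst : ∀ y, (e y).1 = ZMod.castHom (dvd_mul_right 3 n) (ZMod 3) y := fun y =>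
    RingHom.congr_fun (RingHom.ext_zmod ((RingHom.fst _ _).comp e.toRingHom) _) y
  let lift : (ZMod n)ˣ → (ZMod (3 * n))ˣ := fun v =>
    (Units.mapEquiv (e : ZMod (3 * n) ≃* ZMod 3 × ZMod n)).symm (MulEquiv.prodUnits.symm (1, v))
  have hlift : ∀ v, e (lift v) = (1, (v : ZMod n)) := fun v => e.apply_symm_apply _
  have hsum' : ∑ v, f (lift v) = ∑ u, f u := by
    have hinj : Function.Injective lift := fun v w h => by
      have := congrArg (fun u : (ZMod (3 * n))ˣ => e u) h
      simp only [hlift, Prod.mk.injEq, true_and] at this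
      exact Units.ext this
    refine Finset.sum_of_injOn lift hinj.injOn (by simp) ?_ fun _ _ => rfl
    intro u _ hu
    refine hsupp u fun h1 => hu ?_
    refine ⟨(MulEquiv.prodUnits (Units.mapEquiv (e : ZMod (3 * n) ≃* ZMod 3 × ZMod n) u)).2,
      by simp, ?_⟩
    refine Units.ext (e.injective ?_)
    rw [hlift]
    refine Prod.ext ?_ rfl
    rw [hfst]
    exact h1.symm
  have havg : 1 / 2 < unitAverage fun v => f (lift v) := by
    have hpos : (0 : ℝ) < n.totient := by exact_mod_cast Nat.totient_pos.2 (Nat.pos_of_ne_zero hn0)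
    rw [unitAverage, hsum', ZMod.card_units_eq_totient, lt_div_iff₀ hpos]
    rw [Nat.totient_mul hco, Nat.totient_prime (by norm_num : Nat.Prime 3)] at hsum
    push_cast at hsum
    linarith
  obtain ⟨u, v, w, huvw, h⟩ := densityForces_largePositive_zmod n
    (hsf.squarefree_of_dvd (dvd_mul_left _ _)) hn2 hn3 _ (fun _ => hmem _) havg (e x).2
  refine ⟨lift u, lift v, lift w, e.injective ?_, h⟩
  rw [map_add, map_add, hlift, hlift, hlift]
  refine Prod.ext ?_ huvw
  rw [hfst, hx]
  exact (by decide : (0 : ZMod 3) = 1 + 1 + 1)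
end
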